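/- arXiv:2508.17277 — 2 statements merged into one kernel-verified Lean document; each statement's English description precedes it below -/
import Mathlib

section
/- There exist constants C' > 0 and c > 0 such that for every integer m ≥ 2, every set P of n points in the plane in general position with n ≥ C'·m contains either a non-crossing family of size m or a crossing family of size at least n / 2^{c·√(log₂ m)}. -/
open scoped Classical

/-- Points in the plane. -/
abbrev Pt := ℝ × ℝ

/-- A finite planar point set is in general position if no three of its points are collinear. -/
def GenPos (P : Finset Pt) : Prop :=
  ∀ p ∈ P, ∀ q ∈ P, ∀ r ∈ P, p ≠ q → p ≠ r → q ≠ r → ¬ Collinear ℝ ({p, q, r} : Set Pt)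

/-- Two closed segments cross: their intersection is a single point lying in the
relative interior (open segment) of both. -/
def SegCross (s t : Pt × Pt) : Prop :=
  ∃ x : Pt, segment ℝ s.1 s.2 ∩ segment ℝ t.1 t.2 = {x} ∧
    x ∈ openSegment ℝ s.1 s.2 ∧ x ∈ openSegment ℝ t.1 t.2

/-- A crossing family of size `k` in `P`: `k` segments with endpoints in `P`, pairwise crossing. -/
def CrossingFamily (P : Finset Pt) (k : ℕ) : Prop :=
  ∃ F : Finset (Pt × Pt), F.card = k ∧ (∀ e ∈ F, e.1 ∈ P ∧ e.2 ∈ P) ∧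
    ∀ e ∈ F, ∀ f ∈ F, e ≠ f → SegCross e f

/-- A non-crossing family of size `m` in `P`. -/
def NonCrossingFamily (P : Finset Pt) (m : ℕ) : Prop :=
  ∃ P₁ P₂ P₃ P₄ : Finset Pt,
    P₁ ⊆ P ∧ P₂ ⊆ P ∧ P₃ ⊆ P ∧ P₄ ⊆ P ∧
    Disjoint P₁ P₂ ∧ Disjoint P₁ P₃ ∧ Disjoint P₁ P₄ ∧
    Disjoint P₂ P₃ ∧ Disjoint P₂ P₄ ∧ Disjoint P₃ P₄ ∧
    m ≤ P₁.card ∧ m ≤ P₂.card ∧ m ≤ P₃.card ∧ m ≤ P₄.card ∧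
    ∀ p₁ ∈ P₁, ∀ p₂ ∈ P₂, ∀ p₃ ∈ P₃, ∀ p₄ ∈ P₄,
      p₄ ∈ interior (convexHull ℝ ({p₁, p₂, p₃} : Set Pt))

/-- A point set is in convex position if no point lies in the convex hull of the others. -/
def ConvexPos (S : Set Pt) : Prop := ∀ p ∈ S, p ∉ convexHull ℝ (S \ {p})

/-- A convex bundle of size `k` and width `m` in `P`. -/
def ConvexBundle (P : Finset Pt) (k m : ℕ) : Prop :=
  ∃ C : Fin k → Finset Pt, (∀ i, C i ⊆ P) ∧
    (∀ i j, i ≠ j → Disjoint (C i) (C j)) ∧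
    (∀ i, m ≤ (C i).card) ∧
    ∀ f : Fin k → Pt, (∀ i, f i ∈ C i) → ConvexPos (Set.range f)

/-- Two finite point sets are separated if their convex hulls are disjoint. -/
def Separated (A B : Finset Pt) : Prop :=
  Disjoint (convexHull ℝ (A : Set Pt)) (convexHull ℝ (B : Set Pt))

/-- A line in the plane, given by an equation `a * x + b * y = c` with `(a, b) ≠ (0, 0)`. -/
structure Line where
  a : ℝ
  b : ℝ
  c : ℝ
  nondeg : a ≠ 0 ∨ b ≠ 0

/-- The set of points of a line. -/
def Line.toSet (L : Line) : Set Pt := {x | L.a * x.1 + L.b * x.2 = L.c}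

/-- Two lines are parallel if their normal vectors are proportional. -/
def Line.Parallel (L M : Line) : Prop := L.a * M.b - L.b * M.a = 0

/-- A spoke set of size `k` in `P`: `k` pairwise non-parallel lines such that every unbounded
cell of their arrangement (unbounded connected component of the complement of their union)
contains a point of `P`. -/
def SpokeSet (P : Finset Pt) (k : ℕ) : Prop :=
  ∃ ℓ : Fin k → Line,
    (∀ i j, i ≠ j → ¬ (ℓ i).Parallel (ℓ j)) ∧
    ∀ x : Pt, x ∈ (⋃ i, (ℓ i).toSet)ᶜ →
      ¬ Bornology.IsBounded (connectedComponentIn (⋃ i, (ℓ i).toSet)ᶜ x) →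
      ∃ p ∈ P, p ∈ connectedComponentIn (⋃ i, (ℓ i).toSet)ᶜ x

/-- `b` lies strictly to the left of the line through `x` and `y`, oriented from `x` to `y`. -/
def LeftOf (x y b : Pt) : Prop :=
  0 < (y.1 - x.1) * (b.2 - x.2) - (y.2 - x.2) * (b.1 - x.1)

/-- The relation `<_B`: `x <_B y` iff `B` is contained in the open half-plane to the left of
the line through `x` and `y` oriented from `x` towards `y`. -/
def LtRel (B : Finset Pt) (x y : Pt) : Prop :=
  x ≠ y ∧ ∀ b ∈ B, LeftOf x y b

/-- `x` and `y` are incomparable in `<_B`. -/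
def Incomp (B : Finset Pt) (x y : Pt) : Prop := ¬ LtRel B x y ∧ ¬ LtRel B y x

/-- `ι(A, <_B)`: the number of unordered pairs of distinct points of `A`
that are incomparable in `<_B`. -/
noncomputable def iota (A B : Finset Pt) : ℕ :=
  Set.ncard {s : Finset Pt | ∃ x y : Pt, x ≠ y ∧ s = {x, y} ∧ x ∈ A ∧ y ∈ A ∧ Incomp B x y}

/-- `A` and `B` (two `m`-element sets) form an `ε`-avoiding pair. -/
def EpsAvoiding (ε : ℝ) (m : ℕ) (A B : Finset Pt) : Prop :=
  ((iota A B : ℝ) + (iota B A : ℝ)) ≤ ε * (m : ℝ) ^ 2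

/-- The zone of a line `ℓ` in the arrangement of the lines `ℓs`: the union of all cells
(connected components of the complement) whose closure meets `ℓ`. -/
noncomputable def Zone (r : ℕ) (ℓs : Fin r → Line) (ℓ : Line) : Set Pt :=
  {y | ∃ x ∈ (⋃ i, (ℓs i).toSet)ᶜ,
    y ∈ connectedComponentIn (⋃ i, (ℓs i).toSet)ᶜ x ∧
    (closure (connectedComponentIn (⋃ i, (ℓs i).toSet)ᶜ x) ∩ ℓ.toSet).Nonempty}



/-- Orientation determinant. -/
def orr (p q r : Pt) : ℝ := (q.1 - p.1) * (r.2 - p.2) - (q.2 - p.2) * (r.1 - p.1)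

/-- General position in terms of orientations. -/
def GO (P : Finset Pt) : Prop :=
  ∀ p ∈ P, ∀ q ∈ P, ∀ r ∈ P, p ≠ q → p ≠ r → q ≠ r → orr p q r ≠ 0

/-- Orientation criterion for the crossing of `e.1 e.2` and `f.1 f.2`. -/
def Cr (e f : Pt × Pt) : Prop :=
  ∃ σ : ℝ, 0 < σ * orr e.1 f.1 e.2 ∧ 0 < σ * orr e.1 f.1 f.2 ∧
    0 < σ * orr e.2 f.2 e.1 ∧ 0 < σ * orr e.2 f.2 f.1

lemma GO.of_genPos {P : Finset Pt} (h : GenPos P) : GO P := by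
  intro p hp q hq r hr hpq hpr hqr h0
  apply h p hp q hq r hr hpq hpr hqr
  rw [collinear_iff_of_mem (p₀ := p) (by simp)]
  unfold orr at h0
  have hv : q.1 - p.1 ≠ 0 ∨ q.2 - p.2 ≠ 0 := by
    by_contra hc
    push Not at hc
    exact hpq (Prod.ext (by linarith [hc.1]) (by linarith [hc.2]))
  refine ⟨(q.1 - p.1, q.2 - p.2), ?_⟩
  intro x hx
  simp only [Set.mem_insert_iff, Set.mem_singleton_iff] at hx
  rcases hx with rfl | rfl | rfl
  · exact ⟨0, by simp⟩
  · exact ⟨1, by ext <;> simp⟩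
  · rcases hv with hv | hv
    · refine ⟨(x.1 - p.1) / (q.1 - p.1), ?_⟩
      ext
      · simp; field_simp; ring
      · simp; field_simp; linarith
    · refine ⟨(x.2 - p.2) / (q.2 - p.2), ?_⟩
      ext
      · simp; field_simp; linarith
      · simp; field_simp; ring

lemma Cr.segCross {e f : Pt × Pt} (h : Cr e f) : SegCross e f := by
  obtain ⟨σ, h1, h2, h3, h4⟩ := h
  obtain ⟨⟨a1, a2⟩, ⟨b1, b2⟩⟩ := e
  obtain ⟨⟨c1, c2⟩, ⟨d1, d2⟩⟩ := f
  simp only [orr] at h1 h2 h3 h4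
  -- a, c = f.1 ; b, d
  set D : ℝ := (b1 - a1) * (d2 - c2) - (b2 - a2) * (d1 - c1) with hD
  have hDpos : 0 < σ * D := by rw [hD]; nlinarith
  have hD0 : D ≠ 0 := by intro h; rw [h] at hDpos; simp at hDpos
  have hσ0 : σ ≠ 0 := by intro h; rw [h] at hDpos; simp at hDpos
  set s : ℝ := ((c1 - a1) * (d2 - c2) - (c2 - a2) * (d1 - c1)) / D with hs
  set t : ℝ := ((c1 - a1) * (b2 - a2) - (c2 - a2) * (b1 - a1)) / D with ht
  have key : ∀ u : ℝ, 0 < σ * u → 0 < u / D := by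
    intro u hu
    have : u / D = (σ * u) / (σ * D) := by field_simp
    rw [this]; positivity
  have s0 : 0 < s := key _ (by nlinarith)
  have t0 : 0 < t := key _ (by nlinarith)
  have s1 : 0 < 1 - s := by
    have : 1 - s = (D - ((c1 - a1) * (d2 - c2) - (c2 - a2) * (d1 - c1))) / D := by
      rw [hs]; field_simp
    rw [this]; apply key; rw [hD]; nlinarith
  have t1 : 0 < 1 - t := by
    have : 1 - t = (D - ((c1 - a1) * (b2 - a2) - (c2 - a2) * (b1 - a1))) / D := by
      rw [ht]; field_simp
    rw [this]; apply key; rw [hD]; nlinarith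
  have hsD : s * D = (c1 - a1) * (d2 - c2) - (c2 - a2) * (d1 - c1) := by
    rw [hs]; field_simp
  have htD : t * D = (c1 - a1) * (b2 - a2) - (c2 - a2) * (b1 - a1) := by
    rw [ht]; field_simp
  have e1 : (1 - s) * a1 + s * b1 = (1 - t) * c1 + t * d1 := by
    apply mul_right_cancel₀ hD0
    linear_combination (b1 - a1) * hsD - (d1 - c1) * htD + (a1 - c1) * hD
  have e2 : (1 - s) * a2 + s * b2 = (1 - t) * c2 + t * d2 := by
    apply mul_right_cancel₀ hD0
    linear_combination (b2 - a2) * hsD - (d2 - c2) * htD + (a2 - c2) * hD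
  have m1 : ((1 - s) * a1 + s * b1, (1 - s) * a2 + s * b2) ∈ openSegment ℝ (a1, a2) (b1, b2) :=
    ⟨1 - s, s, s1, s0, by ring, by ext <;> simp⟩
  have m2 : ((1 - s) * a1 + s * b1, (1 - s) * a2 + s * b2) ∈ openSegment ℝ (c1, c2) (d1, d2) :=
    ⟨1 - t, t, t1, t0, by ring, by ext <;> simp [e1, e2]⟩
  refine ⟨((1 - s) * a1 + s * b1, (1 - s) * a2 + s * b2), ?_, m1, m2⟩
  apply Set.eq_singleton_iff_unique_mem.2
  refine ⟨⟨openSegment_subset_segment ℝ _ _ m1, openSegment_subset_segment ℝ _ _ m2⟩, ?_⟩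
  rintro ⟨x, y⟩ ⟨⟨u, u', hu, hu', huu, hx⟩, ⟨w, w', hw, hw', hww, hy⟩⟩
  simp only [Prod.smul_mk, smul_eq_mul, Prod.mk_add_mk, Prod.mk.injEq] at hx hy
  have hu1 : u = 1 - u' := by linarith
  have hw1 : w = 1 - w' := by linarith
  subst hu1 hw1
  have : u' = s := by
    apply mul_right_cancel₀ hD0
    rw [hsD, hD]
    linear_combination (d2 - c2) * (hx.1 - hy.1) - (d1 - c1) * (hx.2 - hy.2)
  subst this
  ext <;> simp <;> linarith [hx.1, hx.2]

lemma mem_interior_tri {p q r y : Pt} {σ : ℝ} (h1 : 0 < σ * orr p q y) (h2 : 0 < σ * orr q r y)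
    (h3 : 0 < σ * orr r p y) : y ∈ interior (convexHull ℝ ({p, q, r} : Set Pt)) := by
  have hsub : {y : Pt | 0 < σ * orr p q y ∧ 0 < σ * orr q r y ∧ 0 < σ * orr r p y} ⊆
      convexHull ℝ ({p, q, r} : Set Pt) := by
    rintro y ⟨h1, h2, h3⟩
    set a := σ * orr q r y with ha
    set b := σ * orr r p y with hb
    set c := σ * orr p q y with hc
    have hS : 0 < a + b + c := by positivity
    have hconv := convex_convexHull ℝ ({p, q, r} : Set Pt)
    have hp : p ∈ convexHull ℝ ({p, q, r} : Set Pt) := subset_convexHull ℝ _ (by simp)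
    have hq : q ∈ convexHull ℝ ({p, q, r} : Set Pt) := subset_convexHull ℝ _ (by simp)
    have hr : r ∈ convexHull ℝ ({p, q, r} : Set Pt) := subset_convexHull ℝ _ (by simp)
    have hpq : (a / (a + b)) • p + (b / (a + b)) • q ∈ convexHull ℝ ({p, q, r} : Set Pt) :=
      hconv hp hq (by positivity) (by positivity) (by field_simp)
    have hpqr := hconv hpq hr (a := (a + b) / (a + b + c)) (b := c / (a + b + c))
      (by positivity) (by positivity) (by field_simp)
    have hab : a + b ≠ 0 := by positivity
    convert hpqr using 1
    ext
    · simp only [Prod.fst_add, Prod.smul_fst, smul_eq_mul]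
      field_simp
      rw [ha, hb, hc]; unfold orr; ring
    · simp only [Prod.snd_add, Prod.smul_snd, smul_eq_mul]
      field_simp
      rw [ha, hb, hc]; unfold orr; ring
  have hopen : IsOpen {y : Pt | 0 < σ * orr p q y ∧ 0 < σ * orr q r y ∧ 0 < σ * orr r p y} := by
    have hc : ∀ p q : Pt, Continuous fun y : Pt => σ * orr p q y := by
      intro p q; unfold orr; fun_prop
    exact (isOpen_lt continuous_const (hc p q)).inter
      ((isOpen_lt continuous_const (hc q r)).inter (isOpen_lt continuous_const (hc r p)))
  exact interior_maximal hsub hopen ⟨h1, h2, h3⟩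


lemma median_exists {α : Type*} (L : Finset α) (f : α → ℝ) (a : ℕ) (h : 2 * a ≤ L.card) :
    ∃ t : ℝ, a ≤ (L.filter (fun p => f p ≤ t)).card ∧ a ≤ (L.filter (fun p => t ≤ f p)).card := by
  rcases Nat.eq_zero_or_pos a with rfl | ha
  · exact ⟨0, by simp⟩
  have hne : L.Nonempty := Finset.card_pos.1 (by omega)
  set S := L.filter (fun p => a ≤ (L.filter (fun q => f q ≤ f p)).card) with hS
  have hSne : S.Nonempty := by
    obtain ⟨p, hp, hmax⟩ := L.exists_max_image f hne
    refine ⟨p, ?_⟩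
    rw [hS, Finset.mem_filter]
    refine ⟨hp, ?_⟩
    rw [Finset.filter_true_of_mem hmax]
    omega
  obtain ⟨p, hp, hmin⟩ := S.exists_min_image f hSne
  rw [hS, Finset.mem_filter] at hp
  refine ⟨f p, hp.2, ?_⟩
  have hlt : (L.filter (fun q => f q < f p)).card < a := by
    rcases (L.filter (fun q => f q < f p)).eq_empty_or_nonempty with h0 | h0
    · rw [h0]; simpa using ha
    · obtain ⟨q, hq, hqmax⟩ := (L.filter (fun q => f q < f p)).exists_max_image f h0
      rw [Finset.mem_filter] at hq
      by_contra hc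
      push Not at hc
      have hqS : q ∈ S := by
        rw [hS, Finset.mem_filter]
        refine ⟨hq.1, hc.trans (Finset.card_le_card ?_)⟩
        intro z hz
        have hz' := hqmax z hz
        rw [Finset.mem_filter] at hz ⊢
        exact ⟨hz.1, hz'⟩
      exact absurd (hmin q hqS) (not_le.2 hq.2)
  have hsum := Finset.card_filter_add_card_filter_not (s := L) (fun q => f q < f p)
  simp only [not_lt] at hsum
  omega

lemma half_split {α : Type*} (L : Finset α) (f : α → ℝ) (a : ℕ) (h : 2 * a ≤ L.card) (t : ℝ) :
    a ≤ (L.filter (fun p => f p ≤ t)).card ∨ a ≤ (L.filter (fun p => t ≤ f p)).card := by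
  have hsum := Finset.card_filter_add_card_filter_not (s := L) (fun q => f q ≤ t)
  have : (L.filter (fun q => ¬ f q ≤ t)).card ≤ (L.filter (fun p => t ≤ f p)).card := by
    apply Finset.card_le_card
    intro z hz
    rw [Finset.mem_filter] at hz ⊢
    exact ⟨hz.1, (not_le.1 hz.2).le⟩
  omega

/-- There is a slope `s` and level `t` bisecting both `L` and `R`. -/
lemma ham {L R : Finset Pt} {a c : ℕ} (hL : 2 * a ≤ L.card) (hR : 2 * c ≤ R.card)
    (hLR : ∀ l ∈ L, ∀ r ∈ R, l.1 < r.1) :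
    ∃ s t : ℝ, a ≤ (L.filter (fun p => p.2 - s * p.1 ≤ t)).card ∧
      a ≤ (L.filter (fun p => t ≤ p.2 - s * p.1)).card ∧
      c ≤ (R.filter (fun p => p.2 - s * p.1 ≤ t)).card ∧
      c ≤ (R.filter (fun p => t ≤ p.2 - s * p.1)).card := by
  set E1 : Set ℝ := ⋃ A ∈ L.powersetCard a, ⋃ C ∈ R.powersetCard c,
    ⋂ l ∈ A, ⋂ r ∈ C, {s : ℝ | l.2 - s * l.1 ≤ r.2 - s * r.1} with hE1
  set E2 : Set ℝ := ⋃ A ∈ L.powersetCard a, ⋃ C ∈ R.powersetCard c,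
    ⋂ l ∈ A, ⋂ r ∈ C, {s : ℝ | r.2 - s * r.1 ≤ l.2 - s * l.1} with hE2
  have c1 : IsClosed E1 := by
    refine isClosed_biUnion_finset fun A _ => isClosed_biUnion_finset fun C _ => ?_
    refine isClosed_biInter fun l _ => isClosed_biInter fun r _ => ?_
    exact isClosed_le (by fun_prop) (by fun_prop)
  have c2 : IsClosed E2 := by
    refine isClosed_biUnion_finset fun A _ => isClosed_biUnion_finset fun C _ => ?_
    refine isClosed_biInter fun l _ => isClosed_biInter fun r _ => ?_
    exact isClosed_le (by fun_prop) (by fun_prop)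
  have m1 : ∀ s, s ∈ E1 ↔ ∃ A ⊆ L, A.card = a ∧ ∃ C ⊆ R, C.card = c ∧
      ∀ l ∈ A, ∀ r ∈ C, l.2 - s * l.1 ≤ r.2 - s * r.1 := by
    intro s
    simp only [hE1, Set.mem_iUnion, Set.mem_iInter, Set.mem_ofPred_eq, Finset.mem_powersetCard]
    grind
  have m2 : ∀ s, s ∈ E2 ↔ ∃ A ⊆ L, A.card = a ∧ ∃ C ⊆ R, C.card = c ∧
      ∀ l ∈ A, ∀ r ∈ C, r.2 - s * r.1 ≤ l.2 - s * l.1 := by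
    intro s
    simp only [hE2, Set.mem_iUnion, Set.mem_iInter, Set.mem_ofPred_eq, Finset.mem_powersetCard]
    grind
  have hcover : (Set.univ : Set ℝ) ⊆ E1 ∪ E2 := by
    intro s _
    obtain ⟨t, h1, h2⟩ := median_exists L (fun p => p.2 - s * p.1) a hL
    obtain ⟨A, hA, hAc⟩ := Finset.exists_subset_card_eq h1
    obtain ⟨A', hA', hAc'⟩ := Finset.exists_subset_card_eq h2
    rcases half_split R (fun p => p.2 - s * p.1) c hR t with h | h
    · right
      obtain ⟨C, hC, hCc⟩ := Finset.exists_subset_card_eq h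
      rw [m2]
      refine ⟨A', hA'.trans (Finset.filter_subset _ _), hAc', C,
        hC.trans (Finset.filter_subset _ _), hCc, fun l hl r hr => ?_⟩
      have := (Finset.mem_filter.1 (hA' hl)).2
      have := (Finset.mem_filter.1 (hC hr)).2
      linarith
    · left
      obtain ⟨C, hC, hCc⟩ := Finset.exists_subset_card_eq h
      rw [m1]
      refine ⟨A, hA.trans (Finset.filter_subset _ _), hAc, C,
        hC.trans (Finset.filter_subset _ _), hCc, fun l hl r hr => ?_⟩
      have := (Finset.mem_filter.1 (hA hl)).2
      have := (Finset.mem_filter.1 (hC hr)).2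
      linarith
  obtain ⟨A0, hA0, hA0c⟩ := Finset.exists_subset_card_eq (show a ≤ L.card by omega)
  obtain ⟨C0, hC0, hC0c⟩ := Finset.exists_subset_card_eq (show c ≤ R.card by omega)
  have hbd : ∃ K : ℝ, ∀ l ∈ L, ∀ r ∈ R, |(r.2 - l.2) / (r.1 - l.1)| ≤ K := by
    obtain ⟨K, hK⟩ := ((L ×ˢ R).image
      (fun x => |(x.2.2 - x.1.2) / (x.2.1 - x.1.1)|)).bddAbove
    refine ⟨K, fun l hl r hr => hK ?_⟩
    rw [Finset.mem_coe, Finset.mem_image]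
    exact ⟨(l, r), Finset.mem_product.2 ⟨hl, hr⟩, rfl⟩
  obtain ⟨K, hK⟩ := hbd
  have n1 : (Set.univ ∩ E1).Nonempty := by
    refine ⟨-K, trivial, ?_⟩
    rw [m1]
    refine ⟨A0, hA0, hA0c, C0, hC0, hC0c, fun l hl r hr => ?_⟩
    have h1 := hK l (hA0 hl) r (hC0 hr)
    have h2 := hLR l (hA0 hl) r (hC0 hr)
    have h3 := (abs_le.1 h1).1
    rw [le_div_iff₀ (by linarith)] at h3
    linarith
  have n2 : (Set.univ ∩ E2).Nonempty := by
    refine ⟨K, trivial, ?_⟩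
    rw [m2]
    refine ⟨A0, hA0, hA0c, C0, hC0, hC0c, fun l hl r hr => ?_⟩
    have h1 := hK l (hA0 hl) r (hC0 hr)
    have h2 := hLR l (hA0 hl) r (hC0 hr)
    have h3 := (abs_le.1 h1).2
    rw [div_le_iff₀ (by linarith)] at h3
    linarith
  obtain ⟨s, -, hs1, hs2⟩ := isPreconnected_closed_iff.1 isPreconnected_univ E1 E2 c1 c2 hcover n1 n2
  rw [m1] at hs1
  rw [m2] at hs2
  obtain ⟨A1, hA1, hA1c, C1, hC1, hC1c, h1⟩ := hs1
  obtain ⟨A2, hA2, hA2c, C2, hC2, hC2c, h2⟩ := hs2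
  obtain ⟨tL, hl1, hl2⟩ := median_exists L (fun p => p.2 - s * p.1) a hL
  obtain ⟨tR, hr1, hr2⟩ := median_exists R (fun p => p.2 - s * p.1) c hR
  -- monotonicity helpers
  have up : ∀ (S : Finset Pt) (k : ℕ) (t t' : ℝ), t ≤ t' →
      k ≤ (S.filter (fun p => p.2 - s * p.1 ≤ t)).card →
      k ≤ (S.filter (fun p => p.2 - s * p.1 ≤ t')).card := by
    intro S k t t' htt hk
    refine hk.trans (Finset.card_le_card fun z hz => ?_)
    rw [Finset.mem_filter] at hz ⊢
    exact ⟨hz.1, hz.2.trans htt⟩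
  have dn : ∀ (S : Finset Pt) (k : ℕ) (t t' : ℝ), t' ≤ t →
      k ≤ (S.filter (fun p => t ≤ p.2 - s * p.1)).card →
      k ≤ (S.filter (fun p => t' ≤ p.2 - s * p.1)).card := by
    intro S k t t' htt hk
    refine hk.trans (Finset.card_le_card fun z hz => ?_)
    rw [Finset.mem_filter] at hz ⊢
    exact ⟨hz.1, htt.trans hz.2⟩
  have sub_le : ∀ (S U : Finset Pt) (k : ℕ) (t : ℝ), U ⊆ S → U.card = k →
      (∀ u ∈ U, u.2 - s * u.1 ≤ t) → k ≤ (S.filter (fun p => p.2 - s * p.1 ≤ t)).card := by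
    intro S U k t hU hk h
    rw [← hk]
    exact Finset.card_le_card fun z hz => Finset.mem_filter.2 ⟨hU hz, h z hz⟩
  have sub_ge : ∀ (S U : Finset Pt) (k : ℕ) (t : ℝ), U ⊆ S → U.card = k →
      (∀ u ∈ U, t ≤ u.2 - s * u.1) → k ≤ (S.filter (fun p => t ≤ p.2 - s * p.1)).card := by
    intro S U k t hU hk h
    rw [← hk]
    exact Finset.card_le_card fun z hz => Finset.mem_filter.2 ⟨hU hz, h z hz⟩
  have sep : ∀ (U V : Finset Pt), (∀ u ∈ U, ∀ v ∈ V, u.2 - s * u.1 ≤ v.2 - s * v.1) →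
      ∃ t : ℝ, (∀ u ∈ U, u.2 - s * u.1 ≤ t) ∧ (∀ v ∈ V, t ≤ v.2 - s * v.1) := by
    intro U V h
    rcases U.eq_empty_or_nonempty with rfl | hU
    · rcases V.eq_empty_or_nonempty with rfl | hV
      · exact ⟨0, by simp, by simp⟩
      · obtain ⟨v, hv, hm⟩ := V.exists_min_image (fun p => p.2 - s * p.1) hV
        exact ⟨v.2 - s * v.1, by simp, hm⟩
    · obtain ⟨u, hu, hm⟩ := U.exists_max_image (fun p => p.2 - s * p.1) hU
      exact ⟨u.2 - s * u.1, hm, h u hu⟩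
  rcases le_total tL tR with hle | hle
  · obtain ⟨t2, hC2t, hA2t⟩ := sep C2 A2 (fun u hu v hv => h2 v hv u hu)
    rcases le_total t2 tL with h | h
    · exact ⟨s, tL, hl1, hl2, up R c t2 tL h (sub_le R C2 c t2 hC2 hC2c hC2t),
        dn R c tR tL hle hr2⟩
    · rcases le_total t2 tR with h' | h'
      · exact ⟨s, t2, up L a tL t2 h hl1, sub_ge L A2 a t2 hA2 hA2c hA2t,
          sub_le R C2 c t2 hC2 hC2c hC2t, dn R c tR t2 h' hr2⟩
      · exact ⟨s, tR, up L a tL tR hle hl1, dn L a t2 tR h' (sub_ge L A2 a t2 hA2 hA2c hA2t),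
          hr1, hr2⟩
  · obtain ⟨t2, hA1t, hC1t⟩ := sep A1 C1 h1
    rcases le_total t2 tR with h | h
    · exact ⟨s, tR, up L a t2 tR h (sub_le L A1 a t2 hA1 hA1c hA1t), dn L a tL tR hle hl2,
        hr1, hr2⟩
    · rcases le_total t2 tL with h' | h'
      · exact ⟨s, t2, sub_le L A1 a t2 hA1 hA1c hA1t, dn L a tL t2 h' hl2,
          up R c tR t2 h hr1, sub_ge R C1 c t2 hC1 hC1c hC1t⟩
      · exact ⟨s, tL, hl1, hl2, up R c tR tL hle hr1,
          dn R c t2 tL h' (sub_ge R C1 c t2 hC1 hC1c hC1t)⟩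

/-- Three slab lemma. -/
lemma tsl {L M R : Finset Pt} {a b c : ℕ} (hL : 2 * a ≤ L.card) (hM : 2 * b ≤ M.card)
    (hR : 2 * c ≤ R.card) (hLR : ∀ l ∈ L, ∀ r ∈ R, l.1 < r.1) :
    ∃ σ s t : ℝ, (σ = 1 ∨ σ = -1) ∧ ∃ L' ⊆ L, ∃ M' ⊆ M, ∃ R' ⊆ R,
      L'.card = a ∧ M'.card = b ∧ R'.card = c ∧
      (∀ p ∈ L', σ * (p.2 - s * p.1 - t) ≤ 0) ∧ (∀ p ∈ R', σ * (p.2 - s * p.1 - t) ≤ 0) ∧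
      (∀ p ∈ M', 0 ≤ σ * (p.2 - s * p.1 - t)) := by
  obtain ⟨s, t, h1, h2, h3, h4⟩ := ham hL hR hLR
  rcases half_split M (fun p => p.2 - s * p.1) b hM t with h | h
  · obtain ⟨L', hL', hLc⟩ := Finset.exists_subset_card_eq h2
    obtain ⟨R', hR', hRc⟩ := Finset.exists_subset_card_eq h4
    obtain ⟨M', hM', hMc⟩ := Finset.exists_subset_card_eq h
    refine ⟨-1, s, t, Or.inr rfl, L', hL'.trans (Finset.filter_subset _ _), M',
      hM'.trans (Finset.filter_subset _ _), R', hR'.trans (Finset.filter_subset _ _),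
      hLc, hMc, hRc, fun p hp => ?_, fun p hp => ?_, fun p hp => ?_⟩
    · have := (Finset.mem_filter.1 (hL' hp)).2; linarith
    · have := (Finset.mem_filter.1 (hR' hp)).2; linarith
    · have := (Finset.mem_filter.1 (hM' hp)).2; linarith
  · obtain ⟨L', hL', hLc⟩ := Finset.exists_subset_card_eq h1
    obtain ⟨R', hR', hRc⟩ := Finset.exists_subset_card_eq h3
    obtain ⟨M', hM', hMc⟩ := Finset.exists_subset_card_eq h
    refine ⟨1, s, t, Or.inl rfl, L', hL'.trans (Finset.filter_subset _ _), M',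
      hM'.trans (Finset.filter_subset _ _), R', hR'.trans (Finset.filter_subset _ _),
      hLc, hMc, hRc, fun p hp => ?_, fun p hp => ?_, fun p hp => ?_⟩
    · have := (Finset.mem_filter.1 (hL' hp)).2; linarith
    · have := (Finset.mem_filter.1 (hR' hp)).2; linarith
    · have := (Finset.mem_filter.1 (hM' hp)).2; linarith

/-- Homogeneous orientation of three slabs. -/
lemma hom3 {P L M R : Finset Pt} (hP : GO P) (hLP : L ⊆ P) (hMP : M ⊆ P) (hRP : R ⊆ P)
    {a b c : ℕ} (hL : 2 * a ≤ L.card) (hM : 2 * b ≤ M.card)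
    (hR : 2 * c ≤ R.card) (hLM : ∀ l ∈ L, ∀ r ∈ M, l.1 < r.1) (hMR : ∀ l ∈ M, ∀ r ∈ R, l.1 < r.1)
    (hLR : ∀ l ∈ L, ∀ r ∈ R, l.1 < r.1) :
    ∃ σ : ℝ, (σ = 1 ∨ σ = -1) ∧ ∃ L' ⊆ L, ∃ M' ⊆ M, ∃ R' ⊆ R,
      L'.card = a ∧ M'.card = b ∧ R'.card = c ∧
      (∀ l ∈ L', ∀ m ∈ M', ∀ r ∈ R', σ * orr l m r < 0) := by
  obtain ⟨σ, s, t, hσ, L', hL', M', hM', R', hR', h1, h2, h3, k1, k2, k3⟩ := tsl hL hM hR hLR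
  refine ⟨σ, hσ, L', hL', M', hM', R', hR', h1, h2, h3, fun l hl m hm r hr => ?_⟩
  have x1 := hLM l (hL' hl) m (hM' hm)
  have x2 := hMR m (hM' hm) r (hR' hr)
  have hne : orr l m r ≠ 0 := by
    apply hP l (hLP (hL' hl)) m (hMP (hM' hm)) r (hRP (hR' hr))
    · rintro rfl; exact lt_irrefl _ x1
    · rintro rfl; exact lt_irrefl _ (x1.trans x2)
    · rintro rfl; exact lt_irrefl _ x2
  have hid : σ * orr l m r = (m.1 - l.1) * (σ * (r.2 - s * r.1 - t))
      - (r.1 - l.1) * (σ * (m.2 - s * m.1 - t)) + (r.1 - m.1) * (σ * (l.2 - s * l.1 - t)) := by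
    unfold orr; ring
  have hle : σ * orr l m r ≤ 0 := by
    rw [hid]
    have := mul_nonneg (sub_nonneg.2 x1.le) (neg_nonneg.2 (k2 r hr))
    have := mul_nonneg (sub_nonneg.2 (x1.trans x2).le) (k3 m hm)
    have := mul_nonneg (sub_nonneg.2 x2.le) (neg_nonneg.2 (k1 l hl))
    linarith
  refine lt_of_le_of_ne hle (mul_ne_zero ?_ hne)
  rcases hσ with rfl | rfl <;> norm_num

/-- Sorted blocks. -/
lemma lowest {α : Type*} (f : α → ℝ) (N : ℕ) : ∀ (S : Finset α), Set.InjOn f S → N ≤ S.card →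
    ∃ T ⊆ S, T.card = N ∧ ∀ x ∈ T, ∀ y ∈ S \ T, f x < f y := by
  induction N with
  | zero => intro S _ _; exact ⟨∅, by simp, by simp, by simp⟩
  | succ N ih =>
    intro S hinj hN
    obtain ⟨p, hp, hmin⟩ := S.exists_min_image f (Finset.card_pos.1 (by omega))
    obtain ⟨T, hT, hTc, h⟩ := ih (S.erase p)
      (hinj.mono (by intro x hx; exact Finset.mem_of_mem_erase hx))
      (by rw [Finset.card_erase_of_mem hp]; omega)
    have hpT : p ∉ T := fun hh => by simpa using hT hh
    refine ⟨insert p T, ?_, by rw [Finset.card_insert_of_notMem hpT, hTc], ?_⟩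
    · intro x hx
      rcases Finset.mem_insert.1 hx with rfl | hx
      · exact hp
      · exact Finset.mem_of_mem_erase (hT hx)
    · intro x hx y hy
      rw [Finset.mem_sdiff, Finset.mem_insert, not_or] at hy
      rcases Finset.mem_insert.1 hx with rfl | hx
      · refine lt_of_le_of_ne (hmin y hy.1) fun he => hy.2.1 (hinj hy.1 hp he.symm)
      · exact h x hx y (Finset.mem_sdiff.2 ⟨Finset.mem_erase.2 ⟨hy.2.1, hy.1⟩, hy.2.2⟩)

lemma blocks {α : Type*} (f : α → ℝ) (N : ℕ) (q : ℕ) : ∀ (S : Finset α), Set.InjOn f S →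
    q * N ≤ S.card →
    ∃ blk : ℕ → Finset α, (∀ i, i < q → blk i ⊆ S ∧ (blk i).card = N) ∧
      ∀ i j, i < j → j < q → ∀ x ∈ blk i, ∀ y ∈ blk j, f x < f y := by
  induction q with
  | zero => intro S _ _; exact ⟨fun _ => ∅, by simp, by simp⟩
  | succ q ih =>
    intro S hinj hq
    have e : (q + 1) * N = q * N + N := by ring
    obtain ⟨T, hT, hTc, hlt⟩ := lowest f N S hinj (by omega)
    obtain ⟨blk, h1, h2⟩ := ih (S \ T) (hinj.mono (by intro x hx; exact (Finset.mem_sdiff.1 hx).1))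
      (by rw [Finset.card_sdiff_of_subset hT]; omega)
    refine ⟨fun i => if i = 0 then T else blk (i - 1), ?_, ?_⟩
    · intro i hi
      by_cases h0 : i = 0
      · simp [h0, hT, hTc]
      · simp only [h0, if_false]
        obtain ⟨h3, h4⟩ := h1 (i - 1) (by omega)
        exact ⟨h3.trans Finset.sdiff_subset, h4⟩
    · intro i j hij hj x hx y hy
      have hj0 : j ≠ 0 := by omega
      simp only [hj0, if_false] at hy
      by_cases h0 : i = 0
      · simp only [h0, if_true] at hx
        exact hlt x hx y ((h1 (j - 1) (by omega)).1 hy)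
      · simp only [h0, if_false] at hx
        exact h2 (i - 1) (j - 1) (by omega) (by omega) x hx y hy


/-- The line `x y` strictly splits `B`. -/
def Spl (x y : Pt) (B : Finset Pt) : Prop := (∃ b ∈ B, 0 < orr x y b) ∧ ∃ b ∈ B, orr x y b < 0

/-- Number of ordered pairs of `A` whose line splits `B`. -/
noncomputable def spc (A B : Finset Pt) : ℕ := ((A ×ˢ A).filter (fun p => Spl p.1 p.2 B)).card

lemma Spl.mono {x y : Pt} {B B' : Finset Pt} (h : B' ⊆ B) (hs : Spl x y B') : Spl x y B := by
  obtain ⟨⟨b, hb, h1⟩, ⟨c, hc, h2⟩⟩ := hs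
  exact ⟨⟨b, h hb, h1⟩, ⟨c, h hc, h2⟩⟩

lemma orr_swap (x y b : Pt) : orr y x b = - orr x y b := by unfold orr; ring

lemma orr_cyc (x y b : Pt) : orr y b x = orr x y b := by unfold orr; ring

lemma orr_self (x b : Pt) : orr x x b = 0 := by unfold orr; ring

lemma Spl.symm {x y : Pt} {B : Finset Pt} (hs : Spl x y B) : Spl y x B := by
  obtain ⟨⟨b, hb, h1⟩, ⟨c, hc, h2⟩⟩ := hs
  refine ⟨⟨c, hc, ?_⟩, ⟨b, hb, ?_⟩⟩
  · rw [orr_swap]; linarith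
  · rw [orr_swap]; linarith

lemma spc_mono {A A' B : Finset Pt} (h : A' ⊆ A) : spc A' B ≤ spc A B := by
  apply Finset.card_le_card
  intro z hz
  rw [Finset.mem_filter, Finset.mem_product] at hz ⊢
  exact ⟨⟨h hz.1.1, h hz.1.2⟩, hz.2⟩

lemma Cr.symm {e f : Pt × Pt} (h : Cr e f) : Cr f e := by
  obtain ⟨σ, h1, h2, h3, h4⟩ := h
  refine ⟨-σ, ?_, ?_, ?_, ?_⟩
  · rw [orr_swap]; linarith
  · rw [orr_swap]; linarith
  · rw [orr_swap]; linarith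
  · rw [orr_swap]; linarith

lemma Cr.irrefl {e : Pt × Pt} (h : Cr e e) : False := by
  obtain ⟨σ, h1, -⟩ := h
  rw [orr_self] at h1
  simp at h1

lemma nosplit3 {σ s t : ℝ} (hσ : σ = 1 ∨ σ = -1) {L M R : Finset Pt}
    (hLM : ∀ l ∈ L, ∀ r ∈ M, l.1 < r.1) (hMR : ∀ l ∈ M, ∀ r ∈ R, l.1 < r.1)
    (h1 : ∀ p ∈ L, σ * (p.2 - s * p.1 - t) ≤ 0) (h2 : ∀ p ∈ R, σ * (p.2 - s * p.1 - t) ≤ 0)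
    (h3 : ∀ p ∈ M, 0 ≤ σ * (p.2 - s * p.1 - t)) (x y : Pt) :
    ¬ (Spl x y L ∧ Spl x y M ∧ Spl x y R) := by
  rintro ⟨⟨⟨l, hl, l0⟩, ⟨l', hl', l0'⟩⟩, ⟨⟨m, hm, m0⟩, ⟨m', hm', m0'⟩⟩, ⟨⟨r, hr, r0⟩, ⟨r', hr', r0'⟩⟩⟩
  have hσ2 : σ * σ = 1 := by rcases hσ with rfl | rfl <;> norm_num
  set β : ℝ := (y.1 - x.1) * σ with hβ
  have g : ∀ p : Pt, orr x y p - β * (σ * (p.2 - s * p.1 - t)) =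
      ((y.1 - x.1) * s - (y.2 - x.2)) * p.1 + ((y.1 - x.1) * (t - x.2) + (y.2 - x.2) * x.1) := by
    intro p
    rw [hβ]; unfold orr
    linear_combination (-(y.1 - x.1) * (p.2 - s * p.1 - t)) * hσ2
  set κ := (y.1 - x.1) * s - (y.2 - x.2) with hκ
  set δ := (y.1 - x.1) * (t - x.2) + (y.2 - x.2) * x.1 with hδ
  rcases le_total 0 β with hb | hb
  · have a1 : 0 < κ * l.1 + δ := by
      rw [← g]; nlinarith [mul_nonneg hb (neg_nonneg.2 (h1 l hl))]
    have a2 : 0 < κ * r.1 + δ := by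
      rw [← g]; nlinarith [mul_nonneg hb (neg_nonneg.2 (h2 r hr))]
    have a3 : κ * m'.1 + δ < 0 := by
      rw [← g]; nlinarith [mul_nonneg hb (h3 m' hm')]
    have x1 := sub_pos.2 (hLM l hl m' hm')
    have x2 := sub_pos.2 (hMR m' hm' r hr)
    nlinarith [mul_pos x2 a1, mul_pos x1 a2, mul_pos (add_pos x1 x2) (neg_pos.2 a3)]
  · have a1 : κ * l'.1 + δ < 0 := by
      rw [← g]; nlinarith [mul_nonneg (neg_nonneg.2 hb) (neg_nonneg.2 (h1 l' hl'))]
    have a2 : κ * r'.1 + δ < 0 := by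
      rw [← g]; nlinarith [mul_nonneg (neg_nonneg.2 hb) (neg_nonneg.2 (h2 r' hr'))]
    have a3 : 0 < κ * m.1 + δ := by
      rw [← g]; nlinarith [mul_nonneg (neg_nonneg.2 hb) (h3 m hm)]
    have x1 := sub_pos.2 (hLM l' hl' m hm)
    have x2 := sub_pos.2 (hMR m hm r' hr')
    nlinarith [mul_pos x2 (neg_pos.2 a1), mul_pos x1 (neg_pos.2 a2), mul_pos (add_pos x1 x2) a3]

lemma thin (s : ℕ) : ∀ (d : ℕ) (I : Finset (Pt × Pt)) (B : Finset Pt),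
    Set.InjOn Prod.fst (B : Set Pt) → 6 ^ d * s ≤ B.card →
    ∃ B' ⊆ B, B'.card = s ∧ (I.filter (fun p => Spl p.1 p.2 B')).card * 3 ^ d ≤ 2 ^ d * I.card := by
  intro d
  induction d with
  | zero =>
    intro I B _ hB
    obtain ⟨B', h1, h2⟩ := Finset.exists_subset_card_eq (show s ≤ B.card by simpa using hB)
    exact ⟨B', h1, h2, by simpa using Finset.card_filter_le _ _⟩
  | succ d ih =>
    intro I B hinj hB
    obtain ⟨blk, hb1, hb2⟩ := blocks Prod.fst (2 * (6 ^ d * s)) 3 B hinj (by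
      refine le_trans (le_of_eq ?_) hB; ring)
    have hLM := hb2 0 1 (by norm_num) (by norm_num)
    have hMR := hb2 1 2 (by norm_num) (by norm_num)
    have hLR := hb2 0 2 (by norm_num) (by norm_num)
    obtain ⟨σ, u, t, hσ, L, hL, M, hM, R, hR, cL, cM, cR, k1, k2, k3⟩ :=
      tsl (a := 6 ^ d * s) (b := 6 ^ d * s) (c := 6 ^ d * s)
      (hb1 0 (by norm_num)).2.ge (hb1 1 (by norm_num)).2.ge (hb1 2 (by norm_num)).2.ge hLR
    have hns := nosplit3 hσ (fun l hl m hm => hLM l (hL hl) m (hM hm))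
      (fun l hl m hm => hMR l (hM hl) m (hR hm)) k1 k2 k3
    have hsum : (I.filter (fun p => Spl p.1 p.2 L)).card + (I.filter (fun p => Spl p.1 p.2 M)).card
        + (I.filter (fun p => Spl p.1 p.2 R)).card ≤ 2 * I.card := by
      simp only [Finset.card_filter]
      rw [← Finset.sum_add_distrib, ← Finset.sum_add_distrib, mul_comm, ← smul_eq_mul]
      apply Finset.sum_le_card_nsmul
      intro p _
      have := hns p.1 p.2
      split_ifs <;> simp_all
    have hex : ∃ S ⊆ B, S.card = 6 ^ d * s ∧
        3 * (I.filter (fun p => Spl p.1 p.2 S)).card ≤ 2 * I.card := by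
      by_cases h1 : 3 * (I.filter (fun p => Spl p.1 p.2 L)).card ≤ 2 * I.card
      · exact ⟨L, hL.trans (hb1 0 (by norm_num)).1, cL, h1⟩
      by_cases h2 : 3 * (I.filter (fun p => Spl p.1 p.2 M)).card ≤ 2 * I.card
      · exact ⟨M, hM.trans (hb1 1 (by norm_num)).1, cM, h2⟩
      · exact ⟨R, hR.trans (hb1 2 (by norm_num)).1, cR, by omega⟩
    obtain ⟨S, hSB, hSc, hS⟩ := hex
    obtain ⟨B', h1, h2, h3⟩ := ih (I.filter (fun p => Spl p.1 p.2 S)) S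
      (hinj.mono (by exact_mod_cast hSB)) hSc.ge
    refine ⟨B', h1.trans hSB, h2, ?_⟩
    have heq : (I.filter (fun p => Spl p.1 p.2 S)).filter (fun p => Spl p.1 p.2 B') =
        I.filter (fun p => Spl p.1 p.2 B') := by
      ext p
      simp only [Finset.mem_filter]
      exact ⟨fun h => ⟨h.1.1, h.2⟩, fun h => ⟨⟨h.1, h.2.mono h1⟩, h.2⟩⟩
    rw [heq] at h3
    calc _ = ((I.filter (fun p => Spl p.1 p.2 B')).card * 3 ^ d) * 3 := by ring
      _ ≤ (2 ^ d * (I.filter (fun p => Spl p.1 p.2 S)).card) * 3 := by gcongr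
      _ = 2 ^ d * (3 * (I.filter (fun p => Spl p.1 p.2 S)).card) := by ring
      _ ≤ 2 ^ d * (2 * I.card) := by gcongr
      _ = _ := by ring

lemma start_pair (k s : ℕ) (A B : Finset Pt) (hA : Set.InjOn Prod.fst (A : Set Pt))
    (hB : Set.InjOn Prod.fst (B : Set Pt)) (cA : 6 ^ (10 * k) * s ≤ A.card)
    (cB : 6 ^ (10 * k) * s ≤ B.card) :
    ∃ A' ⊆ A, ∃ B' ⊆ B, A'.card = s ∧ B'.card = s ∧
      (spc A' B' + spc B' A') * 3 ^ k ≤ 2 * 2 ^ k * s ^ 2 := by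
  have h0 : 6 ^ k * s ≤ A.card := by
    refine le_trans ?_ cA
    gcongr
    · norm_num
    · omega
  obtain ⟨A0, hA0, cA0⟩ := Finset.exists_subset_card_eq h0
  obtain ⟨B', hB', cB', h1⟩ := thin s (10 * k) (A0 ×ˢ A0) B hB cB
  obtain ⟨A', hA', cA', h2⟩ := thin s k (B' ×ˢ B') A0 (hA.mono (by exact_mod_cast hA0)) cA0.ge
  refine ⟨A', hA'.trans hA0, B', hB', cA', cB', ?_⟩
  rw [Finset.card_product, cB'] at h2
  rw [Finset.card_product, cA0] at h1
  change spc A0 B' * _ ≤ _ at h1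
  change spc B' A' * _ ≤ _ at h2
  have h3 : spc A' B' * 3 ^ k ≤ 2 ^ k * s ^ 2 := by
    have hpos : 0 < 3 ^ (9 * k) := by positivity
    refine Nat.le_of_mul_le_mul_right ?_ hpos
    have e1 : (2 ^ 9 * 36) ^ k ≤ (3 : ℕ) ^ (9 * k) := by
      rw [pow_mul]; gcongr; norm_num
    calc spc A' B' * 3 ^ k * 3 ^ (9 * k) = spc A' B' * 3 ^ (10 * k) := by
          rw [mul_assoc, ← pow_add]; congr 2; ring
      _ ≤ spc A0 B' * 3 ^ (10 * k) := by gcongr; exact spc_mono hA'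
      _ ≤ 2 ^ (10 * k) * (6 ^ k * s * (6 ^ k * s)) := h1
      _ = 2 ^ k * s ^ 2 * (2 ^ 9 * 36) ^ k := by
          rw [mul_pow, show (36 : ℕ) = 6 * 6 by norm_num, mul_pow, ← pow_mul,
            show 10 * k = k + 9 * k by ring, pow_add]
          ring
      _ ≤ 2 ^ k * s ^ 2 * 3 ^ (9 * k) := by gcongr
  nlinarith


/-- `A` and `B` are separated by a vertical line. -/
def VSep (A B : Finset Pt) : Prop :=
  (∀ a ∈ A, ∀ b ∈ B, a.1 < b.1) ∨ (∀ a ∈ A, ∀ b ∈ B, b.1 < a.1)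

lemma VSep.symm {A B : Finset Pt} (h : VSep A B) : VSep B A := by
  rcases h with h | h
  · exact Or.inr fun b hb a ha => h a ha b hb
  · exact Or.inl fun b hb a ha => h a ha b hb

lemma VSep.mono {A B A' B' : Finset Pt} (h : VSep A B) (hA : A' ⊆ A) (hB : B' ⊆ B) :
    VSep A' B' := by
  rcases h with h | h
  · exact Or.inl fun a ha b hb => h a (hA ha) b (hB hb)
  · exact Or.inr fun a ha b hb => h a (hA ha) b (hB hb)

lemma VSep.mul_pos {A B : Finset Pt} (h : VSep A B) {x y b : Pt} (hx : x ∈ A) (hy : y ∈ A)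
    (hb : b ∈ B) : 0 < (x.1 - b.1) * (y.1 - b.1) := by
  rcases h with h | h
  · have := h x hx b hb
    have := h y hy b hb
    nlinarith
  · have := h x hx b hb
    have := h y hy b hb
    nlinarith

lemma VSep.ne {A B : Finset Pt} (h : VSep A B) {x b : Pt} (hx : x ∈ A) (hb : b ∈ B) : x ≠ b := by
  rintro rfl
  have := h.mul_pos hx hx hb
  simp at this

lemma orr_trans {A B : Finset Pt} (h : VSep A B) {x y z b : Pt} (hx : x ∈ A) (hy : y ∈ A)
    (hz : z ∈ A) (hb : b ∈ B) (h1 : 0 < orr x y b) (h2 : 0 < orr y z b) : 0 < orr x z b := by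
  have e : (y.1-b.1)*orr x z b = (z.1-b.1)*orr x y b + (x.1-b.1)*orr y z b := by
    unfold orr; ring
  have hyy := h.mul_pos hy hy hb
  have hyz := h.mul_pos hy hz hb
  have hyx := h.mul_pos hy hx hb
  have e2 : (y.1-b.1)*(y.1-b.1)*orr x z b
      = (y.1-b.1)*(z.1-b.1)*orr x y b + (y.1-b.1)*(x.1-b.1)*orr y z b := by
    linear_combination (y.1-b.1) * e
  have : 0 < (y.1-b.1)*(y.1-b.1)*orr x z b := by
    rw [e2]; positivity
  exact (pos_iff_pos_of_mul_pos this).1 hyy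

lemma key_lt {A B : Finset Pt} (h : VSep A B) {x y b : Pt} (hx : x ∈ A) (hy : y ∈ A)
    (hb : b ∈ B) : (x.2 - b.2) / (x.1 - b.1) < (y.2 - b.2) / (y.1 - b.1) ↔ 0 < orr x y b := by
  have hxy := h.mul_pos hx hy hb
  have hx0 : x.1 - b.1 ≠ 0 := fun h0 => by simp [h0] at hxy
  have hy0 : y.1 - b.1 ≠ 0 := fun h0 => by simp [h0] at hxy
  have e : orr x y b = ((x.1 - b.1) * (y.1 - b.1)) *
      ((y.2 - b.2) / (y.1 - b.1) - (x.2 - b.2) / (x.1 - b.1)) := by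
    field_simp
    unfold orr; ring
  rw [e, mul_pos_iff_of_pos_left hxy, sub_pos]

lemma chain {P A B : Finset Pt} (hP : GO P) (hAP : A ⊆ P) (hBP : B ⊆ P) (hs : VSep A B)
    (hB : B.Nonempty) {r N : ℕ} (hN : 0 < N) (hA : 4 * r * N ≤ A.card)
    (hspc : spc A B ≤ r * N ^ 2) :
    ∃ blk : ℕ → Finset Pt, (∀ i, i < r → blk i ⊆ A ∧ (blk i).card = N) ∧
      ∀ i j, i < j → j < r → ∀ x ∈ blk i, ∀ y ∈ blk j, ∀ b ∈ B, 0 < orr x y b := by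
  obtain ⟨b0, hb0⟩ := hB
  set D : Pt → ℕ := fun x => (A.filter (fun y => Spl x y B)).card with hD
  have hsum : ∑ x ∈ A, D x = spc A B := by
    unfold spc
    rw [Finset.card_filter, Finset.sum_product]
    apply Finset.sum_congr rfl
    intro x _
    simp only [hD]
    rw [Finset.card_filter]
  set bad := A.filter (fun x => N ≤ 2 * D x) with hbad
  set good := A.filter (fun x => ¬ N ≤ 2 * D x) with hgood
  have hbc : bad.card * N ≤ 2 * (r * N ^ 2) := by
    calc bad.card * N = ∑ x ∈ bad, N := by simp
      _ ≤ ∑ x ∈ bad, 2 * D x := Finset.sum_le_sum fun x hx => (Finset.mem_filter.1 hx).2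
      _ ≤ ∑ x ∈ A, 2 * D x :=
          Finset.sum_le_sum_of_subset (Finset.filter_subset _ _)
      _ = 2 * spc A B := by rw [← Finset.mul_sum, hsum]
      _ ≤ _ := by gcongr
  have hbc2 : bad.card ≤ 2 * r * N := by
    refine Nat.le_of_mul_le_mul_right ?_ hN
    calc _ ≤ _ := hbc
      _ = _ := by ring
  have hgc : 2 * r * N ≤ good.card := by
    have : bad.card + good.card = A.card := by
      rw [hbad, hgood]
      convert Finset.card_filter_add_card_filter_not (s := A) (fun x => N ≤ 2 * D x)
    have e : 4 * r * N = 2 * r * N + 2 * r * N := by ring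
    omega
  have hgA : good ⊆ A := Finset.filter_subset _ _
  have hinj : Set.InjOn (fun x : Pt => (x.2 - b0.2) / (x.1 - b0.1)) (good : Set Pt) := by
    intro x hx y hy hxy
    by_contra hne
    have hxA := hgA hx
    have hyA := hgA hy
    have h1 := (not_congr (key_lt hs hxA hyA hb0)).1 (by simp only at hxy; rw [hxy]; exact lt_irrefl _)
    have h2 := (not_congr (key_lt hs hyA hxA hb0)).1 (by simp only at hxy; rw [hxy]; exact lt_irrefl _)
    rw [orr_swap] at h2
    exact hP x (hAP hxA) y (hAP hyA) b0 (hBP hb0) hne (hs.ne hxA hb0) (hs.ne hyA hb0)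
      (by linarith)
  obtain ⟨blk, hb1, hb2⟩ := blocks (fun x : Pt => (x.2 - b0.2) / (x.1 - b0.1)) N (2 * r) good hinj hgc
  refine ⟨fun i => blk (2 * i), fun i hi => ⟨(hb1 (2*i) (by omega)).1.trans hgA, (hb1 (2*i) (by omega)).2⟩, ?_⟩
  intro i j hij hj x hx y hy
  have hxg := (hb1 (2*i) (by omega)).1 hx
  have hyg := (hb1 (2*j) (by omega)).1 hy
  have hxA := hgA hxg
  have hyA := hgA hyg
  by_contra hcon
  push Not at hcon
  obtain ⟨b, hb, hneg⟩ := hcon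
  -- every middle point is incomparable to `x` or to `y`
  have hcov : blk (2 * i + 1) ⊆ A.filter (fun z => Spl x z B) ∪ A.filter (fun z => Spl y z B) := by
    intro z hz
    have hzg := (hb1 (2*i+1) (by omega)).1 hz
    have hzA := hgA hzg
    have k1 := (key_lt hs hxA hzA hb0).1 (hb2 (2*i) (2*i+1) (by omega) (by omega) x hx z hz)
    have k2 := (key_lt hs hzA hyA hb0).1 (hb2 (2*i+1) (2*j) (by omega) (by omega) z hz y hy)
    rw [Finset.mem_union, Finset.mem_filter, Finset.mem_filter]
    by_cases h1 : 0 < orr x z b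
    · right
      have h2 : ¬ 0 < orr z y b := fun h2 => absurd (orr_trans hs hxA hzA hyA hb h1 h2) (by linarith)
      have hne : z ≠ y := by rintro rfl; rw [orr_self] at k2; exact lt_irrefl _ k2
      have h3 : orr z y b ≠ 0 := hP z (hAP hzA) y (hAP hyA) b (hBP hb) hne (hs.ne hzA hb) (hs.ne hyA hb)
      refine ⟨hzA, Spl.symm ⟨⟨b0, hb0, k2⟩, ⟨b, hb, lt_of_le_of_ne (not_lt.1 h2) h3⟩⟩⟩
    · left
      have hne : x ≠ z := by rintro rfl; rw [orr_self] at k1; exact lt_irrefl _ k1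
      have h3 : orr x z b ≠ 0 := hP x (hAP hxA) z (hAP hzA) b (hBP hb) hne (hs.ne hxA hb) (hs.ne hzA hb)
      refine ⟨hzA, ⟨b0, hb0, k1⟩, ⟨b, hb, lt_of_le_of_ne (not_lt.1 h1) h3⟩⟩
  have hc := (Finset.card_le_card hcov).trans (Finset.card_union_le _ _)
  rw [(hb1 (2*i+1) (by omega)).2] at hc
  have d1 : ¬ N ≤ 2 * D x := (Finset.mem_filter.1 hxg).2
  have d2 : ¬ N ≤ 2 * D y := (Finset.mem_filter.1 hyg).2
  simp only [hD] at d1 d2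
  omega

lemma atmost {x y : Pt} {B B' : Finset Pt} (h : ∀ b ∈ B, ∀ b' ∈ B', 0 < orr b b' x)
    (h1 : Spl x y B) (h2 : Spl x y B') : False := by
  obtain ⟨⟨p, hp, p0⟩, ⟨q, hq, q0⟩⟩ := h1
  obtain ⟨⟨p', hp', p0'⟩, ⟨q', hq', q0'⟩⟩ := h2
  have id : ∀ b1 b2 b3 : Pt, orr b1 b3 x * orr x y b2
      = orr b2 b3 x * orr x y b1 + orr b1 b2 x * orr x y b3 := by
    intro b1 b2 b3; unfold orr; ring
  have a1 := h p hp p' hp'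
  have a2 := h p hp q' hq'
  have a3 := h q hq p' hp'
  have a4 := h q hq q' hq'
  rcases le_total 0 (orr p q x) with h0 | h0
  · have := id p q p'
    nlinarith [mul_pos a1 (neg_pos.2 q0), mul_pos a3 p0, mul_nonneg h0 p0'.le]
  · have := id q p q'
    have e : orr q p x = - orr p q x := by unfold orr; ring
    rw [e] at this
    nlinarith [mul_pos a4 p0, mul_pos a2 (neg_pos.2 q0), mul_nonneg (neg_nonneg.2 h0) (neg_pos.2 q0').le]


lemma sum_spc {A B : Finset Pt} {r : ℕ} {f g : ℕ → Finset Pt} (hf : ∀ i, i < r → f i ⊆ A)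
    (hfd : ∀ i j, i < j → j < r → ∀ x ∈ f i, ∀ y ∈ f j, x ≠ y)
    (hg : ∀ i, i < r → g i ⊆ B)
    (hgo : ∀ i j, i < j → j < r → ∀ x ∈ g i, ∀ y ∈ g j, ∀ a ∈ A, 0 < orr x y a) :
    ∑ p ∈ Finset.range r ×ˢ Finset.range r, spc (f p.1) (g p.2) ≤ spc A B := by
  unfold spc
  rw [← Finset.card_biUnion]
  · apply Finset.card_le_card
    intro z hz
    simp only [Finset.mem_biUnion, Finset.mem_product, Finset.mem_range, Finset.mem_filter] at hz ⊢
    obtain ⟨⟨i, j⟩, ⟨hi, hj⟩, ⟨h1, h2⟩, h3⟩ := hz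
    exact ⟨⟨hf i hi h1, hf i hi h2⟩, h3.mono (hg j hj)⟩
  · rintro ⟨i, j⟩ hij ⟨i', j'⟩ hij' hne
    rw [Function.onFun, Finset.disjoint_left]
    rintro ⟨x, y⟩ hz hz'
    simp only [Finset.mem_product, Finset.mem_range, Finset.mem_filter, Finset.coe_product,
      Set.mem_prod, Finset.mem_coe] at hz hz' hij hij'
    rcases lt_trichotomy i i' with h | h | h
    · exact hfd i i' h hij'.1 x hz.1.1 x hz'.1.1 rfl
    · have hj : j ≠ j' := fun hj => hne (by rw [h, hj])
      have hxA := hf i hij.1 hz.1.1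
      rcases lt_or_gt_of_ne hj with h' | h'
      · exact atmost (fun b hb b' hb' => hgo j j' h' hij'.2 b hb b' hb' x hxA) hz.2 hz'.2
      · exact atmost (fun b hb b' hb' => hgo j' j h' hij.2 b hb b' hb' x hxA) hz'.2 hz.2
    · exact hfd i' i h hij.1 x hz'.1.1 x hz.1.1 rfl

lemma shift_pigeon (σ W : ℕ) (hσ : 0 < σ) (w : ℕ × ℕ → ℕ)
    (h : ∑ p ∈ Finset.range (4 * σ) ×ˢ Finset.range (4 * σ), w p ≤ W) :
    ∃ k, k < 2 * σ ∧ σ ≤ ((Finset.range (2 * σ)).filter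
      (fun i => 2 * σ ^ 2 * w (i, i + k) ≤ W)).card := by
  by_contra hcon
  push Not at hcon
  have h1 : ∑ k ∈ Finset.range (2 * σ), ∑ i ∈ Finset.range (2 * σ), w (i, i + k) ≤ W := by
    refine le_trans ?_ h
    rw [Finset.sum_comm, Finset.sum_product]
    calc _ ≤ ∑ i ∈ Finset.range (2 * σ), ∑ j ∈ Finset.range (4 * σ), w (i, j) := by
          apply Finset.sum_le_sum
          intro i hi
          rw [Finset.mem_range] at hi
          have := Finset.sum_Ico_eq_sum_range (fun j => w (i, j)) i (i + 2 * σ)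
          rw [Nat.add_sub_cancel_left] at this
          rw [← this]
          apply Finset.sum_le_sum_of_subset
          intro j hj
          rw [Finset.mem_Ico] at hj
          rw [Finset.mem_range]
          omega
      _ ≤ _ := by
          apply Finset.sum_le_sum_of_subset
          intro j hj
          rw [Finset.mem_range] at hj ⊢
          omega
  have h2 : ∀ k ∈ Finset.range (2 * σ),
      (σ + 1) * (W + 1) ≤ ∑ i ∈ Finset.range (2 * σ), 2 * σ ^ 2 * w (i, i + k) := by
    intro k hk
    rw [Finset.mem_range] at hk
    have hc := hcon k hk
    have hc2 : ((Finset.range (2 * σ)).filter (fun i => 2 * σ ^ 2 * w (i, i + k) ≤ W)).card +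
      ((Finset.range (2 * σ)).filter (fun i => ¬ 2 * σ ^ 2 * w (i, i + k) ≤ W)).card
        = 2 * σ := by
      convert Finset.card_filter_add_card_filter_not (s := Finset.range (2 * σ))
        (fun i => 2 * σ ^ 2 * w (i, i + k) ≤ W)
      simp
    calc (σ + 1) * (W + 1) ≤
          ((Finset.range (2 * σ)).filter (fun i => ¬ 2 * σ ^ 2 * w (i, i + k) ≤ W)).card * (W + 1) := by
            gcongr; omega
      _ = ∑ i ∈ (Finset.range (2 * σ)).filter (fun i => ¬ 2 * σ ^ 2 * w (i, i + k) ≤ W), (W + 1) := by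
            simp
      _ ≤ ∑ i ∈ (Finset.range (2 * σ)).filter (fun i => ¬ 2 * σ ^ 2 * w (i, i + k) ≤ W),
            2 * σ ^ 2 * w (i, i + k) := by
            apply Finset.sum_le_sum
            intro i hi
            have := (Finset.mem_filter.1 hi).2
            omega
      _ ≤ _ := Finset.sum_le_sum_of_subset (Finset.filter_subset _ _)
  have h3 := Finset.sum_le_sum h2
  simp only [← Finset.mul_sum] at h3
  rw [Finset.sum_const, Finset.card_range, smul_eq_mul] at h3
  have h4 : 2 * σ * ((σ + 1) * (W + 1)) ≤ 2 * σ ^ 2 * W := by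
    refine le_trans (le_of_eq (by ring)) (h3.trans ?_)
    exact Nat.mul_le_mul_left _ h1
  nlinarith

lemma step {P A B : Finset Pt} (hP : GO P) (hAP : A ⊆ P) (hBP : B ⊆ P) (hs : VSep A B)
    {σ N : ℕ} (hσ : 0 < σ) (hN : 0 < N) (hA : 16 * σ * N ≤ A.card) (hB : 16 * σ * N ≤ B.card)
    (hW : spc A B + spc B A ≤ 4 * σ * N ^ 2) :
    ∃ (J : Finset ℕ) (f g : ℕ → Finset Pt), J.card = σ ∧
      (∀ i ∈ J, f i ⊆ A ∧ (f i).card = N ∧ g i ⊆ B ∧ (g i).card = N ∧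
        2 * σ ^ 2 * (spc (f i) (g i) + spc (g i) (f i)) ≤ spc A B + spc B A) ∧
      ∀ i ∈ J, ∀ j ∈ J, i ≠ j → ∀ a ∈ f i, ∀ b ∈ g i, ∀ a' ∈ f j, ∀ b' ∈ g j,
        Cr (a, b) (a', b') := by
  have hpos : 0 < 16 * σ * N := by positivity
  have hAne : A.Nonempty := Finset.card_pos.1 (by omega)
  have hBne : B.Nonempty := Finset.card_pos.1 (by omega)
  obtain ⟨f, f1, f2⟩ := chain (r := 4 * σ) hP hAP hBP hs hBne hN
    (le_trans (le_of_eq (by ring)) hA) (by omega)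
  obtain ⟨g, g1, g2⟩ := chain (r := 4 * σ) hP hBP hAP hs.symm hAne hN
    (le_trans (le_of_eq (by ring)) hB) (by omega)
  have fd : ∀ i j, i < j → j < 4 * σ → ∀ x ∈ f i, ∀ y ∈ f j, x ≠ y := by
    rintro i j hij hj x hx y hy rfl
    obtain ⟨b, hb⟩ := hBne
    have := f2 i j hij hj x hx x hy b hb
    rw [orr_self] at this; exact lt_irrefl _ this
  have gd : ∀ i j, i < j → j < 4 * σ → ∀ x ∈ g i, ∀ y ∈ g j, x ≠ y := by
    rintro i j hij hj x hx y hy rfl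
    obtain ⟨b, hb⟩ := hAne
    have := g2 i j hij hj x hx x hy b hb
    rw [orr_self] at this; exact lt_irrefl _ this
  have s1 := sum_spc (fun i hi => (f1 i hi).1) fd (fun i hi => (g1 i hi).1) g2
  have s2 := sum_spc (fun i hi => (g1 i hi).1) gd (fun i hi => (f1 i hi).1) f2
  have s3 : ∑ p ∈ Finset.range (4 * σ) ×ˢ Finset.range (4 * σ),
      (spc (f p.1) (g p.2) + spc (g p.2) (f p.1)) ≤ spc A B + spc B A := by
    rw [Finset.sum_add_distrib]
    refine add_le_add s1 (le_trans (le_of_eq ?_) s2)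
    rw [Finset.sum_product, Finset.sum_product_right]
  obtain ⟨k, hk, hc⟩ := shift_pigeon σ _ hσ
    (fun p => spc (f p.1) (g p.2) + spc (g p.2) (f p.1)) s3
  obtain ⟨J, hJ, cJ⟩ := Finset.exists_subset_card_eq hc
  refine ⟨J, f, fun i => g (i + k), cJ, ?_, ?_⟩
  · intro i hi
    have hi' := Finset.mem_filter.1 (hJ hi)
    have hi2 := Finset.mem_range.1 hi'.1
    exact ⟨(f1 i (by omega)).1, (f1 i (by omega)).2, (g1 (i + k) (by omega)).1,
      (g1 (i + k) (by omega)).2, hi'.2⟩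
  · have key : ∀ i ∈ J, ∀ j ∈ J, i < j → ∀ a ∈ f i, ∀ b ∈ g (i + k), ∀ a' ∈ f j,
        ∀ b' ∈ g (j + k), Cr (a, b) (a', b') := by
      intro i hi j hj hij a ha b hb a' ha' b' hb'
      have hi2 := Finset.mem_range.1 (Finset.mem_filter.1 (hJ hi)).1
      have hj2 := Finset.mem_range.1 (Finset.mem_filter.1 (hJ hj)).1
      have aA := (f1 i (by omega)).1 ha
      have aA' := (f1 j (by omega)).1 ha'
      have bB := (g1 (i + k) (by omega)).1 hb
      have bB' := (g1 (j + k) (by omega)).1 hb'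
      refine ⟨1, ?_, ?_, ?_, ?_⟩
      · rw [one_mul]; exact f2 i j hij (by omega) a ha a' ha' b bB
      · rw [one_mul]; exact f2 i j hij (by omega) a ha a' ha' b' bB'
      · rw [one_mul]; exact g2 (i+k) (j+k) (by omega) (by omega) b hb b' hb' a aA
      · rw [one_mul]; exact g2 (i+k) (j+k) (by omega) (by omega) b hb b' hb' a' aA'
    intro i hi j hj hij a ha b hb a' ha' b' hb'
    rcases lt_or_gt_of_ne hij with h | h
    · exact key i hi j hj h a ha b hb a' ha' b' hb'
    · exact (key j hj i hi h a' ha' b' hb' a ha b hb).symm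

/-- Union of mutually crossing families. -/
lemma union_fam {ι : Type*} (J : Finset ι) (F : ι → Finset (Pt × Pt)) (c : ℕ)
    (h1 : ∀ i ∈ J, c ≤ (F i).card ∧ ∀ e ∈ F i, ∀ e' ∈ F i, e ≠ e' → Cr e e')
    (h2 : ∀ i ∈ J, ∀ j ∈ J, i ≠ j → ∀ e ∈ F i, ∀ e' ∈ F j, Cr e e') :
    J.card * c ≤ (J.biUnion F).card ∧
      ∀ e ∈ J.biUnion F, ∀ e' ∈ J.biUnion F, e ≠ e' → Cr e e' := by
  constructor
  · rw [Finset.card_biUnion]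
    · rw [← smul_eq_mul]
      exact Finset.card_nsmul_le_sum _ _ _ fun i hi => (h1 i hi).1
    · intro i hi j hj hij
      rw [Function.onFun, Finset.disjoint_left]
      intro e he he'
      exact (h2 i hi j hj hij e he e he').irrefl
  · intro e he e' he' hne
    rw [Finset.mem_biUnion] at he he'
    obtain ⟨i, hi, hei⟩ := he
    obtain ⟨j, hj, hej⟩ := he'
    by_cases hij : i = j
    · subst hij
      exact (h1 i hi).2 e hei e' hej hne
    · exact h2 i hi j hj hij e hei e' hej

lemma recu {P : Finset Pt} (hP : GO P) {σ : ℕ} (hσ : 0 < σ) : ∀ (t : ℕ) (A B : Finset Pt),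
    A ⊆ P → B ⊆ P → VSep A B → A.card = (16 * σ) ^ t → B.card = (16 * σ) ^ t →
    (spc A B + spc B A) * (64 * σ * 128 ^ t) ≤ A.card ^ 2 →
    ∃ F : Finset (Pt × Pt), F ⊆ A ×ˢ B ∧ σ ^ t ≤ F.card ∧ ∀ e ∈ F, ∀ f ∈ F, e ≠ f → Cr e f := by
  intro t
  induction t with
  | zero =>
    intro A B hAP hBP hs hA hB _
    rw [pow_zero] at hA hB
    obtain ⟨a, rfl⟩ := Finset.card_eq_one.1 hA
    obtain ⟨b, rfl⟩ := Finset.card_eq_one.1 hB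
    refine ⟨{(a, b)}, by simp, by simp, ?_⟩
    intro e he f hf hne
    rw [Finset.mem_singleton] at he hf
    exact absurd (he.trans hf.symm) hne
  | succ t ih =>
    intro A B hAP hBP hs hA hB hW
    set N := (16 * σ) ^ t with hN
    have hNpos : 0 < N := by positivity
    have hAN : A.card = 16 * σ * N := by rw [hA, pow_succ, mul_comm]
    have hBN : B.card = 16 * σ * N := by rw [hB, pow_succ, mul_comm]
    set W := spc A B + spc B A with hWdef
    have hW2 : W * 128 ^ (t + 1) ≤ 4 * σ * N ^ 2 := by
      refine Nat.le_of_mul_le_mul_left ?_ (show 0 < 64 * σ by positivity)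
      calc 64 * σ * (W * 128 ^ (t+1)) = W * (64 * σ * 128 ^ (t+1)) := by ring
        _ ≤ A.card ^ 2 := hW
        _ = _ := by rw [hAN]; ring
    have hW3 : W ≤ 4 * σ * N ^ 2 := le_trans (Nat.le_mul_of_pos_right _ (by positivity)) hW2
    obtain ⟨J, f, g, cJ, h1, h2⟩ := step hP hAP hBP hs hσ hNpos hAN.ge hBN.ge hW3
    have hF : ∀ i ∈ J, ∃ F : Finset (Pt × Pt), F ⊆ f i ×ˢ g i ∧ σ ^ t ≤ F.card ∧
        ∀ e ∈ F, ∀ f ∈ F, e ≠ f → Cr e f := by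
      intro i hi
      obtain ⟨a1, a2, a3, a4, a5⟩ := h1 i hi
      refine ih _ _ (a1.trans hAP) (a3.trans hBP) (hs.mono a1 a3) a2 a4 ?_
      rw [a2]
      refine Nat.le_of_mul_le_mul_left ?_ (show 0 < 4 * σ by positivity)
      calc 4 * σ * ((spc (f i) (g i) + spc (g i) (f i)) * (64 * σ * 128 ^ t))
          = 2 * σ ^ 2 * (spc (f i) (g i) + spc (g i) (f i)) * (128 * 128 ^ t) := by ring
        _ ≤ W * (128 * 128 ^ t) := by gcongr
        _ = W * 128 ^ (t + 1) := by ring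
        _ ≤ _ := hW2
    choose! F hF1 hF2 hF3 using hF
    obtain ⟨u1, u2⟩ := union_fam J F (σ ^ t) (fun i hi => ⟨hF2 i hi, hF3 i hi⟩) (by
      intro i hi j hj hij e he e' he'
      have p1 := Finset.mem_product.1 (hF1 i hi he)
      have p2 := Finset.mem_product.1 (hF1 j hj he')
      exact h2 i hi j hj hij e.1 p1.1 e.2 p1.2 e'.1 p2.1 e'.2 p2.2)
    refine ⟨J.biUnion F, ?_, ?_, u2⟩
    · intro e he
      rw [Finset.mem_biUnion] at he
      obtain ⟨i, hi, he⟩ := he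
      have p1 := Finset.mem_product.1 (hF1 i hi he)
      obtain ⟨a1, a2, a3, a4, a5⟩ := h1 i hi
      exact Finset.mem_product.2 ⟨a1 p1.1, a3 p1.2⟩
    · rw [cJ] at u1
      rw [pow_succ, mul_comm]; exact u1


lemma single_fam {A B : Finset Pt} (hA : A.Nonempty) (hB : B.Nonempty) :
    ∃ F : Finset (Pt × Pt), F ⊆ A ×ˢ B ∧ F.card = 1 ∧ ∀ e ∈ F, ∀ f ∈ F, e ≠ f → Cr e f := by
  obtain ⟨a, ha⟩ := hA
  obtain ⟨b, hb⟩ := hB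
  refine ⟨{(a, b)}, by simp [ha, hb], by simp, ?_⟩
  intro e he f hf hne
  rw [Finset.mem_singleton] at he hf
  exact absurd (he.trans hf.symm) hne

lemma thmI {P A B : Finset Pt} (hP : GO P) (hAP : A ⊆ P) (hBP : B ⊆ P) (hs : VSep A B)
    (hAi : Set.InjOn Prod.fst (A : Set Pt)) (hBi : Set.InjOn Prod.fst (B : Set Pt))
    {m : ℕ} (hm : 0 < m) (hA : m ≤ A.card) (hB : m ≤ B.card) :
    ∃ F : Finset (Pt × Pt), F ⊆ A ×ˢ B ∧ (∀ e ∈ F, ∀ f ∈ F, e ≠ f → Cr e f) ∧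
      2 ^ (Nat.log 2 m) ≤ F.card * 2 ^ (500 * Nat.sqrt (Nat.log 2 m) + 1500) := by
  set l := Nat.log 2 m with hl
  set u := Nat.sqrt l with hu
  have hlm : 2 ^ l ≤ m := Nat.pow_log_le_self 2 hm.ne'
  have hlu : l < (u + 1) * (u + 1) := Nat.lt_succ_sqrt l
  clear_value u
  clear_value l
  by_cases hc : l < 52 * u + 364
  · obtain ⟨F, h1, h2, h3⟩ := single_fam (A := A) (B := B)
      (Finset.card_pos.1 (by omega)) (Finset.card_pos.1 (by omega))
    refine ⟨F, h1, h3, ?_⟩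
    rw [h2, one_mul]
    exact Nat.pow_le_pow_right (by norm_num) (by omega)
  push Not at hc
  set t := (l - 52 * u - 364) / (u + 368) with ht
  have t1 : t * (u + 368) ≤ l - 52 * u - 364 := Nat.div_mul_le_self _ _
  have t2 : l - 52 * u - 364 < (t + 1) * (u + 368) := by
    have := Nat.lt_mul_div_succ (l - 52 * u - 364) (show 0 < u + 368 by omega)
    rw [← ht] at this
    rw [mul_comm (t + 1)]
    exact this
  clear_value t
  have t3 : t ≤ u + 1 := by
    by_contra hcon
    push Not at hcon
    have h1 : (u + 2) * (u + 368) ≤ t * (u + 368) := by gcongr; omega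
    have h2 : t * (u + 368) ≤ l := le_trans t1 (by omega)
    nlinarith
  set e := 7 + u + 7 * t with he
  set s := (16 * 2 ^ u) ^ t with hs'
  have hs2 : s = 2 ^ ((u + 4) * t) := by
    rw [hs', show (16 : ℕ) = 2 ^ 4 by norm_num, ← pow_add, ← pow_mul]; congr 1; ring
  have hsize : 6 ^ (10 * (2 * e)) * s ≤ m := by
    refine le_trans ?_ hlm
    calc 6 ^ (10 * (2 * e)) * s = (6 ^ 20) ^ e * s := by rw [← pow_mul]; congr 2; ring
      _ ≤ (2 ^ 52) ^ e * s := by gcongr ?_ ^ e * s; norm_num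
      _ = 2 ^ (52 * e + (u + 4) * t) := by rw [hs2, ← pow_mul, ← pow_add]
      _ ≤ 2 ^ l := by
        apply Nat.pow_le_pow_right (by norm_num)
        have : 52 * e + (u + 4) * t = 364 + 52 * u + t * (u + 368) := by rw [he]; ring
        omega
  obtain ⟨A', hA', B', hB', cA, cB, hW⟩ := start_pair (2 * e) s A B hAi hBi
    (hsize.trans hA) (hsize.trans hB)
  obtain ⟨F, F1, F2, F3⟩ := recu hP (σ := 2 ^ u) (by positivity) t A' B' (hA'.trans hAP)
    (hB'.trans hBP) (hs.mono hA' hB') cA cB (by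
      rw [cA]
      refine Nat.le_of_mul_le_mul_left ?_ (show 0 < 2 * 2 ^ (2 * e) by positivity)
      refine le_trans ?_ hW
      rw [mul_left_comm]
      refine Nat.mul_le_mul_left _ ?_
      calc 2 * 2 ^ (2 * e) * (64 * 2 ^ u * 128 ^ t) = 2 ^ (2 * e) * 2 ^ e := by
            rw [show (128 : ℕ) = 2 ^ 7 by norm_num, he, pow_add 2 (7 + u), pow_add 2 7, pow_mul 2 7 t]
            ring
        _ = 8 ^ e := by rw [pow_mul, ← mul_pow]; norm_num
        _ ≤ 9 ^ e := by gcongr; norm_num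
        _ = 3 ^ (2 * e) := by rw [pow_mul]; norm_num)
  refine ⟨F, F1.trans (Finset.product_subset_product hA' hB'), F3, ?_⟩
  calc 2 ^ l ≤ 2 ^ (u * t + (500 * u + 1500)) := by
        apply Nat.pow_le_pow_right (by norm_num)
        have e1 : (t + 1) * (u + 368) = u * t + 368 * t + u + 368 := by ring
        omega
    _ = (2 ^ u) ^ t * 2 ^ (500 * u + 1500) := by rw [pow_add, pow_mul]
    _ ≤ _ := by gcongr


/-- Non-crossing family in orientation form. -/
def NCO (P : Finset Pt) (m : ℕ) : Prop :=
  ∃ P₁ P₂ P₃ P₄ : Finset Pt, P₁ ⊆ P ∧ P₂ ⊆ P ∧ P₃ ⊆ P ∧ P₄ ⊆ P ∧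
    m ≤ P₁.card ∧ m ≤ P₂.card ∧ m ≤ P₃.card ∧ m ≤ P₄.card ∧
    ∃ σ : ℝ, ∀ p ∈ P₁, ∀ q ∈ P₂, ∀ r ∈ P₃, ∀ y ∈ P₄,
      0 < σ * orr p q y ∧ 0 < σ * orr q r y ∧ 0 < σ * orr r p y

lemma four_pt {τ : ℝ} {p q r s : Pt} (h1 : p.1 < q.1) (h2 : q.1 < r.1) (h3 : r.1 < s.1)
    (a : τ * orr p q r < 0) (b : τ * orr q r s < 0) :
    τ * orr p q s < 0 ∧ τ * orr p r s < 0 := by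
  have e1 : (r.1 - q.1) * (τ * orr p q s)
      = (s.1 - q.1) * (τ * orr p q r) + (q.1 - p.1) * (τ * orr q r s) := by unfold orr; ring
  have e2 : (r.1 - q.1) * (τ * orr p r s)
      = (s.1 - r.1) * (τ * orr p q r) + (r.1 - p.1) * (τ * orr q r s) := by unfold orr; ring
  have h0 : 0 < r.1 - q.1 := by linarith
  constructor
  · by_contra hc
    push Not at hc
    nlinarith [mul_nonneg h0.le hc, mul_pos (show 0 < s.1 - q.1 by linarith) (neg_pos.2 a),
      mul_pos (show 0 < q.1 - p.1 by linarith) (neg_pos.2 b)]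
  · by_contra hc
    push Not at hc
    nlinarith [mul_nonneg h0.le hc, mul_pos (show 0 < s.1 - r.1 by linarith) (neg_pos.2 a),
      mul_pos (show 0 < r.1 - p.1 by linarith) (neg_pos.2 b)]

lemma cap_seq {τ : ℝ} {q : ℕ} {p : ℕ → Pt} (hx : ∀ i j, i < j → j < q → (p i).1 < (p j).1)
    (hc : ∀ i, i + 2 < q → τ * orr (p i) (p (i+1)) (p (i+2)) < 0) :
    ∀ i j k, i < j → j < k → k < q → τ * orr (p i) (p j) (p k) < 0 := by
  have A : ∀ d i, i + d + 2 < q → τ * orr (p i) (p (i + d + 1)) (p (i + d + 2)) < 0 := by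
    intro d
    induction d with
    | zero => intro i hi; exact hc i hi
    | succ d ih =>
      intro i hi
      have h1 := ih i (by omega)
      have h2 := hc (i + d + 1) (by omega)
      exact (four_pt (hx _ _ (by omega) (by omega)) (hx _ _ (by omega) (by omega))
        (hx _ _ (by omega) (by omega)) h1 h2).2
  have B : ∀ d i j, i < j → j + d + 1 < q → τ * orr (p i) (p j) (p (j + d + 1)) < 0 := by
    intro d
    induction d with
    | zero =>
      intro i j hij hj
      obtain ⟨e, rfl⟩ := Nat.exists_eq_add_of_lt hij
      exact A e i (by omega)
    | succ d ih =>
      intro i j hij hj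
      have h1 := ih i j hij (by omega)
      have h2 := A d j (by omega)
      exact (four_pt (hx _ _ (by omega) (by omega)) (hx _ _ (by omega) (by omega))
        (hx _ _ (by omega) (by omega)) h1 h2).1
  intro i j k hij hjk hk
  obtain ⟨e, rfl⟩ := Nat.exists_eq_add_of_lt hjk
  exact B e i j hij hk

lemma cap_all {τ : ℝ} {q : ℕ} {C : ℕ → Finset Pt} (hne : ∀ i, i < q → (C i).Nonempty)
    (hx : ∀ i j, i < j → j < q → ∀ x ∈ C i, ∀ y ∈ C j, x.1 < y.1)
    (hc : ∀ i, i + 2 < q → ∀ x ∈ C i, ∀ y ∈ C (i+1), ∀ z ∈ C (i+2), τ * orr x y z < 0) :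
    ∀ i j k, i < j → j < k → k < q → ∀ x ∈ C i, ∀ y ∈ C j, ∀ z ∈ C k, τ * orr x y z < 0 := by
  intro i j k hij hjk hk x hx' y hy z hz
  choose! p0 hp0 using hne
  set p : ℕ → Pt := fun l => if l = i then x else if l = j then y else if l = k then z else p0 l
    with hp
  have hpC : ∀ l, l < q → p l ∈ C l := by
    intro l hl
    simp only [hp]
    split_ifs with h1 h2 h3
    · rw [h1]; exact hx'
    · rw [h2]; exact hy
    · rw [h3]; exact hz
    · exact hp0 l hl
  have := cap_seq (τ := τ) (q := q) (p := p)
    (fun a b hab hb => hx a b hab hb _ (hpC a (by omega)) _ (hpC b hb))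
    (fun a ha => hc a ha _ (hpC a (by omega)) _ (hpC _ (by omega)) _ (hpC _ ha)) i j k hij hjk hk
  have e1 : p i = x := by simp [hp]
  have e2 : p j = y := by simp [hp, hij.ne']
  have e3 : p k = z := by simp [hp, hjk.ne', (hij.trans hjk).ne']
  rwa [e1, e2, e3] at this

/-- If a triple of blocks is a cup, we find a non-crossing family. -/
lemma cup_case {P Gl X Y Z Gr : Finset Pt} {τ : ℝ} (hτ : τ = 1 ∨ τ = -1) {m : ℕ} (hP : GO P)
    (hGl : Gl ⊆ P) (hX : X ⊆ P) (hY : Y ⊆ P) (hZ : Z ⊆ P) (hGr : Gr ⊆ P)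
    (cGl : 2 * m ≤ Gl.card) (cX : m ≤ X.card) (cY : 2 * m ≤ Y.card) (cZ : 2 * m ≤ Z.card)
    (cGr : m ≤ Gr.card)
    (o1 : ∀ a ∈ Gl, ∀ b ∈ Y, a.1 < b.1) (o2 : ∀ a ∈ Gl, ∀ b ∈ Z, a.1 < b.1)
    (o3 : ∀ a ∈ X, ∀ b ∈ Y, a.1 < b.1) (o4 : ∀ a ∈ Y, ∀ b ∈ Z, a.1 < b.1)
    (o5 : ∀ a ∈ Y, ∀ b ∈ Gr, a.1 < b.1)
    (hG : ∀ a ∈ Gl, ∀ y ∈ Y, ∀ b ∈ Gr, τ * orr a y b < 0)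
    (hcup : ∀ x ∈ X, ∀ y ∈ Y, ∀ z ∈ Z, 0 < τ * orr x y z) : NCO P m := by
  obtain ⟨ρ, hρ, G', hG', Y', hY', Z', hZ', c1, c2, c3, hh⟩ :=
    hom3 hP hGl hY hZ cGl cY cZ o1 o4 o2
  have hcases : ρ = τ ∨ ρ = -τ := by
    rcases hτ with rfl | rfl <;> rcases hρ with rfl | rfl <;> simp
  rcases hcases with rfl | rfl
  · refine ⟨G', X, Z', Y', hG'.trans hGl, hX, hZ'.trans hZ, hY'.trans hY, c1.ge, cX, c3.ge, c2.ge,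
      -ρ, ?_⟩
    intro g hg x hx z hz y hy
    have k1 := hh g hg y hy z hz
    have k2 := hcup x hx y (hY' hy) z (hZ' hz)
    have x1 := o1 g (hG' hg) y (hY' hy)
    have x2 := o3 x hx y (hY' hy)
    have x3 := o4 y (hY' hy) z (hZ' hz)
    have e : (z.1 - y.1) * (-ρ * orr g x y)
      = (y.1 - g.1) * (ρ * orr x y z) - (y.1 - x.1) * (ρ * orr g y z) := by
      unfold orr; ring
    have e1 : orr x z y = - orr x y z := by unfold orr; ring
    have e2 : orr z g y = orr g y z := by unfold orr; ring
    refine ⟨?_, by rw [e1]; linarith, by rw [e2]; linarith⟩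
    by_contra hc
    push Not at hc
    nlinarith [mul_nonneg (show 0 ≤ z.1 - y.1 by linarith) (neg_nonneg.2 hc),
      mul_pos (show 0 < y.1 - g.1 by linarith) k2,
      mul_pos (show 0 < y.1 - x.1 by linarith) (neg_pos.2 k1)]
  · refine ⟨G', Z', Gr, Y', hG'.trans hGl, hZ'.trans hZ, hGr, hY'.trans hY, c1.ge, c3.ge, cGr, c2.ge,
      -τ, ?_⟩
    intro g hg z hz r hr y hy
    have k1 := hh g hg y hy z hz
    have k2 := hG g (hG' hg) y (hY' hy) r hr
    have x1 := o1 g (hG' hg) y (hY' hy)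
    have x2 := o5 y (hY' hy) r hr
    have x3 := o4 y (hY' hy) z (hZ' hz)
    have e : (y.1 - g.1) * (-τ * orr z r y)
      = - (r.1 - y.1) * (-τ * orr g y z) - (z.1 - y.1) * (τ * orr g y r) := by
      unfold orr; ring
    have e1 : orr g z y = - orr g y z := by unfold orr; ring
    have e2 : orr r g y = orr g y r := by unfold orr; ring
    refine ⟨by rw [e1]; linarith, ?_, by rw [e2]; linarith⟩
    by_contra hc
    push Not at hc
    nlinarith [mul_nonneg (show 0 ≤ y.1 - g.1 by linarith) (neg_nonneg.2 hc),
      mul_pos (show 0 < r.1 - y.1 by linarith) (neg_pos.2 k1),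
      mul_pos (show 0 < z.1 - y.1 by linarith) (neg_pos.2 k2)]

lemma caps {P Gl Gr : Finset Pt} {τ : ℝ} (hτ : τ = 1 ∨ τ = -1) {m q : ℕ} (hP : GO P)
    {C : ℕ → Finset Pt}
    (hGl : Gl ⊆ P) (hGr : Gr ⊆ P) (hCP : ∀ i, i < q → C i ⊆ P) (cC : ∀ i, i < q → 16 * m ≤ (C i).card)
    (cGl : 2 * m ≤ Gl.card) (cGr : m ≤ Gr.card)
    (hx : ∀ i j, i < j → j < q → ∀ x ∈ C i, ∀ y ∈ C j, x.1 < y.1)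
    (o1 : ∀ i, i < q → ∀ a ∈ Gl, ∀ b ∈ C i, a.1 < b.1)
    (o2 : ∀ i, i < q → ∀ a ∈ C i, ∀ b ∈ Gr, a.1 < b.1)
    (hG : ∀ i, i < q → ∀ a ∈ Gl, ∀ y ∈ C i, ∀ b ∈ Gr, τ * orr a y b < 0) (hN : ¬ NCO P m) (i : ℕ) :
    ∃ D : ℕ → Finset Pt, (∀ j, D j ⊆ C j) ∧ (∀ j, j < q → 2 * m ≤ (D j).card) ∧
      (∀ j, j < q → i ≤ j → 4 * m ≤ (D j).card) ∧
      (∀ j, j < q → i + 1 ≤ j → 8 * m ≤ (D j).card) ∧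
      (∀ j, j < q → i + 2 ≤ j → 16 * m ≤ (D j).card) ∧
      ∀ j, j < i → j + 2 < q → ∀ x ∈ D j, ∀ y ∈ D (j+1), ∀ z ∈ D (j+2), τ * orr x y z < 0 := by
  induction i with
  | zero =>
    refine ⟨C, fun j => subset_rfl, ?_, ?_, ?_, ?_, ?_⟩
    · intro j hj; have := cC j hj; omega
    · intro j hj _; have := cC j hj; omega
    · intro j hj _; have := cC j hj; omega
    · intro j hj _; have := cC j hj; omega
    · intro j hj; omega
  | succ i ih =>
    obtain ⟨D, d0, d1, d2, d3, d4, d5⟩ := ih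
    by_cases hi : i + 2 < q
    swap
    · refine ⟨D, d0, d1, fun j hj h => d2 j hj (by omega), fun j hj h => d3 j hj (by omega),
        fun j hj h => d4 j hj (by omega), ?_⟩
      intro j hj hjq
      exact d5 j (by omega) hjq
    have hDx : ∀ i j, i < j → j < q → ∀ x ∈ D i, ∀ y ∈ D j, x.1 < y.1 :=
      fun i j hij hj x hx' y hy => hx i j hij hj x (d0 i hx') y (d0 j hy)
    have hDP : ∀ i, i < q → D i ⊆ P := fun i hi => (d0 i).trans (hCP i hi)
    have q1 := d2 i (by omega) le_rfl
    have q2 := d3 (i+1) (by omega) le_rfl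
    have q3 := d4 (i+2) (by omega) le_rfl
    obtain ⟨ρ, hρ, X, hX, Y, hY, Z, hZ, c1, c2, c3, hh⟩ :=
      hom3 (a := 2 * m) (b := 4 * m) (c := 8 * m) hP (hDP i (by omega)) (hDP (i+1) (by omega))
        (hDP (i+2) hi) (by omega) (by omega) (by omega)
        (hDx _ _ (by omega) (by omega)) (hDx _ _ (by omega) (by omega)) (hDx _ _ (by omega) (by omega))
    have hcases : ρ = τ ∨ ρ = -τ := by
      rcases hτ with rfl | rfl <;> rcases hρ with rfl | rfl <;> simp
    rcases hcases with rfl | rfl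
    swap
    · exfalso
      apply hN
      refine cup_case (X := X) (Y := Y) (Z := Z) hτ hP hGl (hX.trans (hDP i (by omega)))
        (hY.trans (hDP (i+1) (by omega)))
        (hZ.trans (hDP (i+2) hi)) hGr cGl (by omega) (by omega) (by omega) cGr ?_ ?_ ?_ ?_ ?_ ?_ ?_
      · exact fun a ha b hb => o1 (i+1) (by omega) a ha b (d0 _ (hY hb))
      · exact fun a ha b hb => o1 (i+2) (by omega) a ha b (d0 _ (hZ hb))
      · exact fun a ha b hb => hDx i (i+1) (by omega) (by omega) a (hX ha) b (hY hb)
      · exact fun a ha b hb => hDx (i+1) (i+2) (by omega) (by omega) a (hY ha) b (hZ hb)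
      · exact fun a ha b hb => o2 (i+1) (by omega) a (d0 _ (hY ha)) b hb
      · exact fun a ha y hy b hb => hG (i+1) (by omega) a ha y (d0 _ (hY hy)) b hb
      · intro x hx y hy z hz
        have := hh x hx y hy z hz
        linarith
    · set E : ℕ → Finset Pt := fun j => if j = i then X else if j = i + 1 then Y else
        if j = i + 2 then Z else D j with hE
      have E0 : E i = X := by simp [hE]
      have E1 : E (i+1) = Y := by simp [hE]
      have E2 : E (i+2) = Z := by simp [hE]
      have E3 : ∀ j, j ≠ i → j ≠ i + 1 → j ≠ i + 2 → E j = D j := by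
        intro j h1 h2 h3
        simp [hE, h1, h2, h3]
      have ED : ∀ j, E j ⊆ D j := by
        intro j
        simp only [hE]
        split_ifs with h1 h2 h3
        · rw [h1]; exact hX
        · rw [h2]; exact hY
        · rw [h3]; exact hZ
        · exact subset_rfl
      have hcases : ∀ j, j = i ∨ j = i + 1 ∨ j = i + 2 ∨ (j ≠ i ∧ j ≠ i + 1 ∧ j ≠ i + 2) := by
        intro j; omega
      refine ⟨E, fun j => (ED j).trans (d0 j), ?_, ?_, ?_, ?_, ?_⟩
      · intro j hj
        rcases hcases j with rfl | rfl | rfl | ⟨h1, h2, h3⟩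
        · rw [E0]; omega
        · rw [E1]; omega
        · rw [E2]; omega
        · rw [E3 j h1 h2 h3]; exact d1 j hj
      · intro j hj hji
        rcases hcases j with rfl | rfl | rfl | ⟨h1, h2, h3⟩
        · omega
        · rw [E1]; omega
        · rw [E2]; omega
        · rw [E3 j h1 h2 h3]; exact d2 j hj (by omega)
      · intro j hj hji
        rcases hcases j with rfl | rfl | rfl | ⟨h1, h2, h3⟩
        · omega
        · omega
        · rw [E2]; omega
        · rw [E3 j h1 h2 h3]; exact d3 j hj (by omega)
      · intro j hj hji
        rw [E3 j (by omega) (by omega) (by omega)]; exact d4 j hj (by omega)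
      · intro j hj hjq
        by_cases hji : j = i
        · subst hji
          rw [E0, E1, E2]; exact hh
        · intro x hx' y hy z hz
          exact d5 j (by omega) hjq x (ED _ hx') y (ED _ hy) z (ED _ hz)

lemma partII {P : Finset Pt} (hP : GO P) (hi : Set.InjOn Prod.fst (P : Set Pt)) {m : ℕ}
    (hm : 0 < m) (hn : 400 * m ≤ P.card) : NCO P m ∨
    ∃ (h : ℕ) (F : Finset (Pt × Pt)), P.card ≤ 384 * m * h ∧ F ⊆ P ×ˢ P ∧
      (∀ e ∈ F, ∀ f ∈ F, e ≠ f → Cr e f) ∧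
      h * 2 ^ (Nat.log 2 m) ≤ F.card * 2 ^ (500 * Nat.sqrt (Nat.log 2 m) + 1500) := by
  by_cases hN : NCO P m
  · exact Or.inl hN
  right
  set w := P.card / 6 with hw
  obtain ⟨S, s1, s2⟩ := blocks Prod.fst (2 * w) 3 P hi (by omega)
  have b0 := s1 0 (by omega)
  have b1 := s1 1 (by omega)
  have b2 := s1 2 (by omega)
  obtain ⟨τ, hτ, Gl, hGl, M, hM, Gr, hGr, c1, c2, c3, hh⟩ :=
    hom3 (a := w) (b := w) (c := w) hP b0.1 b1.1 b2.1 b0.2.ge b1.2.ge b2.2.ge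
      (s2 0 1 (by omega) (by omega)) (s2 1 2 (by omega) (by omega)) (s2 0 2 (by omega) (by omega))
  set q := w / (16 * m) with hq
  have hqw : q * (16 * m) ≤ w := Nat.div_mul_le_self _ _
  have hqw2 : w < 16 * m * (q + 1) := Nat.lt_mul_div_succ _ (by omega)
  have hq4 : 4 ≤ q := by
    rw [hq, Nat.le_div_iff_mul_le (by omega)]; omega
  have hMi : Set.InjOn Prod.fst (M : Set Pt) := hi.mono (by
    exact_mod_cast hM.trans b1.1)
  obtain ⟨C, C1, C2⟩ := blocks Prod.fst (16 * m) q M hMi (by omega)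
  have hCP : ∀ i, i < q → C i ⊆ P := fun i hi => ((C1 i hi).1.trans hM).trans b1.1
  obtain ⟨D, d0, d1, -, -, -, d5⟩ := caps hτ hP (hGl.trans b0.1) (hGr.trans b2.1) hCP
    (fun i hi => (C1 i hi).2.ge) (m := m) (by omega) (by omega) C2
    (fun i hi a ha b hb => s2 0 1 (by omega) (by omega) a (hGl ha) b (hM ((C1 i hi).1 hb)))
    (fun i hi a ha b hb => s2 1 2 (by omega) (by omega) a (hM ((C1 i hi).1 ha)) b (hGr hb))
    (fun i hi a ha y hy b hb => hh a ha y ((C1 i hi).1 hy) b hb) hN q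
  have hDx : ∀ i j, i < j → j < q → ∀ x ∈ D i, ∀ y ∈ D j, x.1 < y.1 :=
      fun i j hij hj x hx' y hy => C2 i j hij hj x (d0 i hx') y (d0 j hy)
  have hDP : ∀ i, i < q → D i ⊆ P := fun i hi => (d0 i).trans (hCP i hi)
  have hcap := cap_all (τ := τ) (C := D) (q := q)
    (fun i hi => Finset.card_pos.1 (by have := d1 i hi; omega)) hDx
    (fun i hi => d5 i (by omega) hi)
  set h := q / 2 with hh'
  have hF : ∀ i ∈ Finset.range h, ∃ F : Finset (Pt × Pt), F ⊆ D i ×ˢ D (i + h) ∧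
      (∀ e ∈ F, ∀ f ∈ F, e ≠ f → Cr e f) ∧
      2 ^ (Nat.log 2 m) ≤ F.card * 2 ^ (500 * Nat.sqrt (Nat.log 2 m) + 1500) := by
    intro i hi'
    rw [Finset.mem_range] at hi'
    have e1 := d1 i (by omega)
    have e2 := d1 (i + h) (by omega)
    refine thmI hP (hDP i (by omega)) (hDP (i + h) (by omega))
      (Or.inl (hDx i (i+h) (by omega) (by omega))) ?_ ?_ hm (by omega) (by omega)
    · exact hi.mono (by exact_mod_cast hDP i (by omega))
    · exact hi.mono (by exact_mod_cast hDP (i+h) (by omega))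
  choose! F F1 F2 F3 using hF
  have hcr : ∀ i j, i < j → j < h → ∀ e ∈ F i, ∀ e' ∈ F j, Cr e e' := by
    intro i j hij hj e he e' he'
    have p1 := Finset.mem_product.1 (F1 i (Finset.mem_range.2 (by omega)) he)
    have p2 := Finset.mem_product.1 (F1 j (Finset.mem_range.2 hj) he')
    refine ⟨-τ, ?_, ?_, ?_, ?_⟩
    · have := hcap i j (i+h) hij (by omega) (by omega) _ p1.1 _ p2.1 _ p1.2
      linarith
    · have := hcap i j (j+h) hij (by omega) (by omega) _ p1.1 _ p2.1 _ p2.2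
      linarith
    · have := hcap i (i+h) (j+h) (by omega) (by omega) (by omega) _ p1.1 _ p1.2 _ p2.2
      rw [orr_cyc]
      linarith
    · have := hcap j (i+h) (j+h) (by omega) (by omega) (by omega) _ p2.1 _ p1.2 _ p2.2
      rw [orr_cyc]
      linarith
  set K := 2 ^ (500 * Nat.sqrt (Nat.log 2 m) + 1500) with hK
  have hcrs : ∀ i ∈ Finset.range h, ∀ j ∈ Finset.range h, i ≠ j →
      ∀ e ∈ F i, ∀ e' ∈ F j, Cr e e' := by
    intro i hi' j hj' hij e he e' he'
    rcases lt_or_gt_of_ne hij with h0 | h0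
    · exact hcr i j h0 (Finset.mem_range.1 hj') e he e' he'
    · exact (hcr j i h0 (Finset.mem_range.1 hi') e' he' e he).symm
  obtain ⟨-, u2⟩ := union_fam (Finset.range h) F 0 (fun i hi' => ⟨Nat.zero_le _, F2 i hi'⟩) hcrs
  refine ⟨h, (Finset.range h).biUnion F, ?_, ?_, u2, ?_⟩
  · have : 16 * m * (q + 1) ≤ 16 * m * (3 * h) := by gcongr; omega
    have e : 16 * m * (3 * h) * 8 = 384 * m * h := by ring
    omega
  · intro e he
    rw [Finset.mem_biUnion] at he
    obtain ⟨i, hi', he⟩ := he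
    have p1 := Finset.mem_product.1 (F1 i hi' he)
    rw [Finset.mem_range] at hi'
    exact Finset.mem_product.2 ⟨hDP i (by omega) p1.1, hDP (i+h) (by omega) p1.2⟩
  · rw [Finset.card_biUnion, Finset.sum_mul]
    · calc h * 2 ^ Nat.log 2 m = ∑ i ∈ Finset.range h, 2 ^ Nat.log 2 m := by simp
        _ ≤ _ := Finset.sum_le_sum fun i hi' => F3 i hi'
    · intro i hi' j hj' hij
      rw [Function.onFun, Finset.disjoint_left]
      intro e he he'
      exact (hcrs i hi' j hj' hij e he e he').irrefl


/-- Horizontal shear. -/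
def shear (δ : ℝ) (p : Pt) : Pt := (p.1 + δ * p.2, p.2)

lemma shear_neg (δ : ℝ) (p : Pt) : shear (-δ) (shear δ p) = p := by
  unfold shear; ext <;> simp

lemma shear_neg' (δ : ℝ) (p : Pt) : shear δ (shear (-δ) p) = p := by
  unfold shear; ext <;> simp

lemma shear_inj (δ : ℝ) : Function.Injective (shear δ) := fun p q h => by
  rw [← shear_neg δ p, h, shear_neg]

lemma orr_shear (δ : ℝ) (p q r : Pt) : orr (shear δ p) (shear δ q) (shear δ r) = orr p q r := by
  unfold orr shear; ring

lemma exists_shear (P : Finset Pt) : ∃ δ : ℝ,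
    Set.InjOn Prod.fst ((P.image (shear δ) : Finset Pt) : Set Pt) := by
  obtain ⟨δ, hδ⟩ := Infinite.exists_notMem_finset
    ((P ×ˢ P).image (fun z : Pt × Pt => - (z.1.1 - z.2.1) / (z.1.2 - z.2.2)))
  refine ⟨δ, ?_⟩
  intro x hx y hy hxy
  rw [Finset.mem_coe, Finset.mem_image] at hx hy
  obtain ⟨p, hp, rfl⟩ := hx
  obtain ⟨q, hq, rfl⟩ := hy
  have h : p.1 + δ * p.2 = q.1 + δ * q.2 := hxy
  by_cases h2 : p.2 = q.2
  · have h1 : p.1 = q.1 := by rw [h2] at h; linarith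
    rw [Prod.ext h1 h2]
  · exfalso
    apply hδ
    rw [Finset.mem_image]
    refine ⟨(p, q), Finset.mem_product.2 ⟨hp, hq⟩, ?_⟩
    have : p.2 - q.2 ≠ 0 := sub_ne_zero.2 h2
    simp only
    field_simp
    linarith

lemma NCO.unshear {P : Finset Pt} {m : ℕ} {δ : ℝ} (h : NCO (P.image (shear δ)) m) : NCO P m := by
  obtain ⟨P₁, P₂, P₃, P₄, a1, a2, a3, a4, c1, c2, c3, c4, σ, hσ⟩ := h
  have sub : ∀ Q : Finset Pt, Q ⊆ P.image (shear δ) → Q.image (shear (-δ)) ⊆ P := by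
    intro Q hQ x hx
    rw [Finset.mem_image] at hx
    obtain ⟨y, hy, rfl⟩ := hx
    obtain ⟨z, hz, rfl⟩ := Finset.mem_image.1 (hQ hy)
    rw [shear_neg]; exact hz
  refine ⟨P₁.image (shear (-δ)), P₂.image (shear (-δ)), P₃.image (shear (-δ)),
    P₄.image (shear (-δ)), sub _ a1, sub _ a2, sub _ a3, sub _ a4, ?_, ?_, ?_, ?_, σ, ?_⟩
  · rwa [Finset.card_image_of_injective _ (shear_inj _)]
  · rwa [Finset.card_image_of_injective _ (shear_inj _)]
  · rwa [Finset.card_image_of_injective _ (shear_inj _)]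
  · rwa [Finset.card_image_of_injective _ (shear_inj _)]
  · intro p hp q hq r hr y hy
    obtain ⟨p, hp', rfl⟩ := Finset.mem_image.1 hp
    obtain ⟨q, hq', rfl⟩ := Finset.mem_image.1 hq
    obtain ⟨r, hr', rfl⟩ := Finset.mem_image.1 hr
    obtain ⟨y, hy', rfl⟩ := Finset.mem_image.1 hy
    rw [orr_shear, orr_shear, orr_shear]
    exact hσ p hp' q hq' r hr' y hy'

lemma NCO.toNCF {P : Finset Pt} {m : ℕ} (hm : 0 < m) (h : NCO P m) : NonCrossingFamily P m := by
  obtain ⟨P₁, P₂, P₃, P₄, a1, a2, a3, a4, c1, c2, c3, c4, σ, hσ⟩ := h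
  obtain ⟨p, hp⟩ : P₁.Nonempty := Finset.card_pos.1 (by omega)
  obtain ⟨q, hq⟩ : P₂.Nonempty := Finset.card_pos.1 (by omega)
  obtain ⟨r, hr⟩ : P₃.Nonempty := Finset.card_pos.1 (by omega)
  obtain ⟨y, hy⟩ : P₄.Nonempty := Finset.card_pos.1 (by omega)
  have z1 : ∀ a b : Pt, orr a a b = 0 := fun a b => orr_self a b
  have z2 : ∀ a b : Pt, orr a b a = 0 := fun a b => by unfold orr; ring
  refine ⟨P₁, P₂, P₃, P₄, a1, a2, a3, a4, ?_, ?_, ?_, ?_, ?_, ?_, c1, c2, c3, c4, ?_⟩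
  · rw [Finset.disjoint_left]; intro x h1 h2
    have := (hσ x h1 x h2 r hr y hy).1
    simp [z1] at this
  · rw [Finset.disjoint_left]; intro x h1 h2
    have := (hσ x h1 q hq x h2 y hy).2.2
    simp [z1] at this
  · rw [Finset.disjoint_left]; intro x h1 h2
    have := (hσ x h1 q hq r hr x h2).1
    simp [z2] at this
  · rw [Finset.disjoint_left]; intro x h1 h2
    have := (hσ p hp x h1 x h2 y hy).2.1
    simp [z1] at this
  · rw [Finset.disjoint_left]; intro x h1 h2
    have := (hσ p hp x h1 r hr x h2).2.1
    simp [z2] at this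
  · rw [Finset.disjoint_left]; intro x h1 h2
    have := (hσ p hp q hq x h1 x h2).2.2
    simp [z2] at this
  · intro p hp q hq r hr y hy
    obtain ⟨h1, h2, h3⟩ := hσ p hp q hq r hr y hy
    exact mem_interior_tri h1 h2 h3

lemma main_nat {P : Finset Pt} (hP : GO P) {m : ℕ} (hm : 0 < m) (hn : 400 * m ≤ P.card) :
    NonCrossingFamily P m ∨
    ∃ h k : ℕ, P.card ≤ 384 * m * h ∧ CrossingFamily P k ∧
      h * 2 ^ (Nat.log 2 m) ≤ k * 2 ^ (500 * Nat.sqrt (Nat.log 2 m) + 1500) := by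
  obtain ⟨δ, hδ⟩ := exists_shear P
  have hP' : GO (P.image (shear δ)) := by
    intro p hp q hq r hr h1 h2 h3
    obtain ⟨p, hp', rfl⟩ := Finset.mem_image.1 hp
    obtain ⟨q, hq', rfl⟩ := Finset.mem_image.1 hq
    obtain ⟨r, hr', rfl⟩ := Finset.mem_image.1 hr
    rw [orr_shear]
    exact hP p hp' q hq' r hr' (fun h => h1 (by rw [h])) (fun h => h2 (by rw [h]))
      (fun h => h3 (by rw [h]))
  have hc : (P.image (shear δ)).card = P.card := Finset.card_image_of_injective _ (shear_inj _)
  rcases partII hP' hδ hm (by rw [hc]; exact hn) with h | ⟨h, F, f1, f2, f3, f4⟩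
  · exact Or.inl (h.unshear.toNCF hm)
  right
  set φ : Pt × Pt → Pt × Pt := fun e => (shear (-δ) e.1, shear (-δ) e.2) with hφ
  have φi : Function.Injective φ := by
    intro e f hef
    have h1 := shear_inj _ (congrArg Prod.fst hef)
    have h2 := shear_inj _ (congrArg Prod.snd hef)
    exact Prod.ext h1 h2
  refine ⟨h, F.card, by rw [← hc]; exact f1, ⟨F.image φ, Finset.card_image_of_injective _ φi, ?_, ?_⟩, f4⟩
  · intro e he
    obtain ⟨e, he', rfl⟩ := Finset.mem_image.1 he
    have := Finset.mem_product.1 (f2 he')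
    obtain ⟨z1, hz1, e1⟩ := Finset.mem_image.1 this.1
    obtain ⟨z2, hz2, e2⟩ := Finset.mem_image.1 this.2
    simp only [hφ]
    rw [← e1, ← e2, shear_neg, shear_neg]
    exact ⟨hz1, hz2⟩
  · intro e he f hf hne
    obtain ⟨e, he', rfl⟩ := Finset.mem_image.1 he
    obtain ⟨f, hf', rfl⟩ := Finset.mem_image.1 hf
    obtain ⟨σ, k1, k2, k3, k4⟩ := f3 e he' f hf' (fun h => hne (by rw [h]))
    apply Cr.segCross
    refine ⟨σ, ?_, ?_, ?_, ?_⟩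
    · simp only [hφ]; rw [orr_shear]; exact k1
    · simp only [hφ]; rw [orr_shear]; exact k2
    · simp only [hφ]; rw [orr_shear]; exact k3
    · simp only [hφ]; rw [orr_shear]; exact k4

/-- There exist constants `C' > 0` and `c > 0` such that for every integer `m ≥ 2`,
every set `P` of `n` points in the plane in general position with `n ≥ C'·m` contains either a
non-crossing family of size `m` or a crossing family of size at least `n / 2^(c·√(log₂ m))`. -/
theorem stmt2 :
    ∃ C' c : ℝ, 0 < C' ∧ 0 < c ∧ ∀ m : ℕ, 2 ≤ m →
      ∀ P : Finset Pt, GenPos P → C' * (m : ℝ) ≤ (P.card : ℝ) →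
        NonCrossingFamily P m ∨
        ∃ k : ℕ, (P.card : ℝ) / 2 ^ (c * Real.sqrt (Real.logb 2 (m : ℝ))) ≤ (k : ℝ) ∧
          CrossingFamily P k := by
  refine ⟨400, 2010, by norm_num, by norm_num, ?_⟩
  intro m hm P hP hn
  have hn' : 400 * m ≤ P.card := by exact_mod_cast hn
  rcases main_nat (GO.of_genPos hP) (show 0 < m by omega) hn' with h | ⟨h, k, h1, h2, h3⟩
  · exact Or.inl h
  right
  refine ⟨k, ?_, h2⟩
  set l := Nat.log 2 m with hl
  set u := Nat.sqrt l with hu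
  set κ := Real.sqrt (Real.logb 2 (m : ℝ)) with hκ
  have hm0 : (0 : ℝ) < m := by exact_mod_cast (show 0 < m by omega)
  have hlm : 2 ^ l ≤ m := Nat.pow_log_le_self 2 (by omega)
  have hml : m ≤ 2 ^ (l + 1) := (Nat.lt_pow_succ_log_self (by norm_num) m).le
  have hlog : (l : ℝ) ≤ Real.logb 2 (m : ℝ) := by
    rw [Real.le_logb_iff_rpow_le (by norm_num) hm0, Real.rpow_natCast]
    exact_mod_cast hlm
  have hu2 : u * u ≤ l := Nat.sqrt_le l
  have huκ : (u : ℝ) ≤ κ := by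
    apply Real.le_sqrt_of_sq_le
    refine le_trans ?_ hlog
    rw [sq]; exact_mod_cast hu2
  have hκ1 : 1 ≤ κ := by
    apply Real.le_sqrt_of_sq_le
    rw [Real.le_logb_iff_rpow_le (by norm_num) hm0]
    norm_num
    exact_mod_cast hm
  have hnat : P.card ≤ k * 2 ^ (500 * u + 1510) := by
    calc P.card ≤ 384 * m * h := h1
      _ ≤ 384 * 2 ^ (l + 1) * h := by gcongr
      _ = 768 * (h * 2 ^ l) := by ring
      _ ≤ 768 * (k * 2 ^ (500 * u + 1500)) := by gcongr
      _ ≤ 1024 * (k * 2 ^ (500 * u + 1500)) := by gcongr; norm_num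
      _ = k * 2 ^ (500 * u + 1510) := by
        rw [show 500 * u + 1510 = 10 + (500 * u + 1500) by omega, pow_add 2 10]
        generalize 2 ^ (500 * u + 1500) = X
        ring
  have hreal : (P.card : ℝ) ≤ k * 2 ^ (2010 * κ) := by
    generalize hE : 500 * u + 1510 = E at hnat
    have hE2 : (E : ℝ) ≤ 2010 * κ := by rw [← hE]; push_cast; linarith
    calc (P.card : ℝ) ≤ k * 2 ^ E := by exact_mod_cast hnat
      _ = k * (2 : ℝ) ^ ((E : ℕ) : ℝ) := by rw [Real.rpow_natCast]
      _ ≤ k * (2 : ℝ) ^ (2010 * κ) := by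
        exact mul_le_mul_of_nonneg_left
          (Real.rpow_le_rpow_of_exponent_le (by norm_num) hE2) (Nat.cast_nonneg k)
  rw [div_le_iff₀ (by positivity)]
  exact hreal
end

section
/- There exists a constant c > 0 with the following property: for every set P of n ≥ 2 points in the plane in general position and every partition of P into two separated subsets P₁ and P₂ with ||P₁| − |P₂|| ≤ 1, the set P contains a crossing family of size at least n / 2^{c·√(log₂ n)} in which every segment has one endpoint in P₁ and one endpoint in P₂. -/
open scoped Classical

namespace CF

/-- Consecutive blocks of a finite set with respect to an injective real function. -/
lemma exists_blocks {α : Type*} (f : α → ℝ) (m : ℕ) :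
    ∀ (q : ℕ) (S : Finset α), Set.InjOn f S → q * m ≤ S.card →
      ∃ g : ℕ → Finset α, (∀ i < q, g i ⊆ S ∧ (g i).card = m) ∧
        ∀ i j, i < j → j < q → ∀ x ∈ g i, ∀ y ∈ g j, f x < f y := by
  intro q S hf hq
  let r : α → ℕ := fun x => (S.filter (fun y => f y < f x)).card
  have hmono : ∀ x ∈ S, ∀ y ∈ S, f x < f y → r x < r y := by
    intro x hx y hy hxy
    apply Finset.card_lt_card
    rw [Finset.ssubset_iff_of_subset]
    · exact ⟨x, by simp [hx, hxy], by simp⟩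
    · intro z hz
      simp only [Finset.mem_filter] at hz ⊢
      exact ⟨hz.1, hz.2.trans hxy⟩
  have hinj : Set.InjOn r S := by
    intro x hx y hy hxy
    by_contra hne
    have : f x ≠ f y := fun h => hne (hf hx hy h)
    rcases lt_or_gt_of_ne this with h | h
    · exact absurd hxy (hmono x hx y hy h).ne
    · exact absurd hxy (hmono y hy x hx h).ne'
  have himg : S.image r = Finset.range S.card := by
    apply Finset.eq_of_subset_of_card_le
    · intro n hn
      obtain ⟨x, hx, rfl⟩ := Finset.mem_image.1 hn
      rw [Finset.mem_range]
      apply Finset.card_lt_card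
      rw [Finset.ssubset_iff_of_subset (Finset.filter_subset _ _)]
      exact ⟨x, hx, by simp⟩
    · rw [Finset.card_image_of_injOn hinj, Finset.card_range]
  refine ⟨fun i => S.filter (fun x => i * m ≤ r x ∧ r x < (i + 1) * m), ?_, ?_⟩
  · intro i hi
    refine ⟨Finset.filter_subset _ _, ?_⟩
    have : (S.filter (fun x => i * m ≤ r x ∧ r x < (i + 1) * m)).image r
        = Finset.Ico (i * m) ((i + 1) * m) := by
      ext n
      simp only [Finset.mem_image, Finset.mem_filter, Finset.mem_Ico]
      constructor
      · rintro ⟨x, ⟨_, h⟩, rfl⟩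
        exact h
      · intro h
        have h1 : (i + 1) * m ≤ q * m := Nat.mul_le_mul_right _ hi
        have : n ∈ S.image r := by
          rw [himg, Finset.mem_range]; omega
        obtain ⟨x, hx, rfl⟩ := Finset.mem_image.1 this
        exact ⟨x, ⟨hx, h⟩, rfl⟩
    rw [← Finset.card_image_of_injOn (f := r) (hinj.mono (by intro x hx; simp at hx; exact hx.1)),
      this, Nat.card_Ico, Nat.add_mul]
    omega
  · intro i j hij hj x hx y hy
    simp only [Finset.mem_filter] at hx hy
    have h1 : (i + 1) * m ≤ j * m := Nat.mul_le_mul_right _ hij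
    by_contra hlt
    rcases (not_lt.1 hlt).lt_or_eq with h | h
    · have := hmono y hy.1 x hx.1 h
      omega
    · have := hf hy.1 hx.1 h
      subst this
      omega

/-- Ordered incomparable pairs of `A` with respect to `B`. -/
noncomputable def inc {α β : Type*} (σ : α → β → ℝ) (A : Finset α) (B : Finset β) :
    Finset (α × α) :=
  (A ×ˢ A).filter (fun p => ∃ b ∈ B, ∃ c ∈ B, σ p.1 b < σ p.2 b ∧ σ p.2 c < σ p.1 c)

/-- The order-theoretic properties of the slope function used in the recursion. -/
structure Half {α β : Type*} (σ : α → β → ℝ) (A : Finset α) (B : Finset β) : Prop where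
  col : ∀ x ∈ A, ∀ y ∈ A, x ≠ y → ∀ b ∈ B, σ x b ≠ σ y b
  thr : ∀ x ∈ A, ∀ y ∈ A,
    (∀ b ∈ B, ∀ b' ∈ B, σ x b < σ x b' → σ x b < σ y b → σ x b' < σ y b') ∨
    (∀ b ∈ B, ∀ b' ∈ B, σ x b < σ x b' → σ x b' < σ y b' → σ x b < σ y b)

lemma Half.mono {α β : Type*} {σ : α → β → ℝ} {A A' : Finset α} {B B' : Finset β}
    (h : Half σ A B) (hA : A' ⊆ A) (hB : B' ⊆ B) : Half σ A' B' := by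
  refine ⟨fun x hx y hy hn b hb => h.col x (hA hx) y (hA hy) hn b (hB hb), fun x hx y hy => ?_⟩
  rcases h.thr x (hA hx) y (hA hy) with h | h
  · exact Or.inl fun b hb b' hb' => h b (hB hb) b' (hB hb')
  · exact Or.inr fun b hb b' hb' => h b (hB hb) b' (hB hb')

lemma exists_groups {α β : Type*} {σ : α → β → ℝ} {A : Finset α} {B : Finset β}
    (h : Half σ A B) (hB : B.Nonempty) (k m : ℕ) (hm : 0 < m) (hA : A.card = 5 * k * m)
    (hinc : 2 * (inc σ A B).card ≤ k * m ^ 2) :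
    ∃ g : ℕ → Finset α, (∀ i < 2 * k, g i ⊆ A ∧ (g i).card = m) ∧
      ∀ i j, i < j → j < 2 * k → ∀ x ∈ g i, ∀ y ∈ g j, ∀ b ∈ B, σ x b < σ y b := by
  obtain ⟨b₀, hb₀⟩ := hB
  let deg : α → ℕ := fun x => (A.filter (fun y => (x, y) ∈ inc σ A B)).card
  have hsum : ∑ x ∈ A, deg x = (inc σ A B).card := by
    have : inc σ A B = (A ×ˢ A).filter (fun p => (p.1, p.2) ∈ inc σ A B) := by
      ext p
      simp only [Finset.mem_filter, inc]
      exact ⟨fun h => ⟨h.1, h⟩, fun h => h.2⟩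
    rw [this, Finset.card_filter, Finset.sum_product]
    apply Finset.sum_congr rfl
    intro x _
    rw [← Finset.card_filter]
  let good := A.filter (fun x => 2 * deg x < m)
  let bad := A.filter (fun x => ¬ 2 * deg x < m)
  have hgb : good.card + bad.card = A.card := Finset.card_filter_add_card_filter_not _
  have hbad : bad.card * m ≤ k * m ^ 2 := by
    calc bad.card * m = ∑ x ∈ bad, m := by simp
      _ ≤ ∑ x ∈ bad, 2 * deg x := by
        apply Finset.sum_le_sum
        intro x hx
        exact not_lt.1 (Finset.mem_filter.1 hx).2
      _ ≤ ∑ x ∈ A, 2 * deg x :=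
        Finset.sum_le_sum_of_subset (Finset.filter_subset _ _)
      _ = 2 * (inc σ A B).card := by rw [← Finset.mul_sum, hsum]
      _ ≤ _ := hinc
  have hbad' : bad.card ≤ k * m := by
    rw [pow_two, ← mul_assoc] at hbad
    exact Nat.le_of_mul_le_mul_right hbad hm
  have hgood : (4 * k) * m ≤ good.card := by
    have e1 : 5 * k * m = 5 * (k * m) := by ring
    have e2 : 4 * k * m = 4 * (k * m) := by ring
    omega
  have hgA : good ⊆ A := Finset.filter_subset _ _
  have hinj : Set.InjOn (fun x => σ x b₀) good := by
    intro x hx y hy hxy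
    by_contra hne
    exact h.col x (hgA hx) y (hgA hy) hne b₀ hb₀ hxy
  obtain ⟨g, hg1, hg2⟩ := exists_blocks (fun x => σ x b₀) m (4 * k) good hinj hgood
  refine ⟨fun i => g (2 * i), fun i hi => ?_, ?_⟩
  · obtain ⟨h1, h2⟩ := hg1 (2 * i) (by omega)
    exact ⟨h1.trans hgA, h2⟩
  · intro i j hij hj x hx y hy b hb
    have hxg := (hg1 (2 * i) (by omega)).1 hx
    have hyg := (hg1 (2 * j) (by omega)).1 hy
    obtain ⟨hs, hc⟩ := hg1 (2 * i + 1) (by omega)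
    have hxA := hgA hxg
    have hyA := hgA hyg
    have hz : ∃ z ∈ g (2 * i + 1), (x, z) ∉ inc σ A B ∧ (y, z) ∉ inc σ A B := by
      by_contra hcon
      push Not at hcon
      have hsub : g (2 * i + 1) ⊆ A.filter (fun z => (x, z) ∈ inc σ A B) ∪
          A.filter (fun z => (y, z) ∈ inc σ A B) := by
        intro z hz
        have hzA := hgA (hs hz)
        by_cases hxz : (x, z) ∈ inc σ A B
        · exact Finset.mem_union_left _ (Finset.mem_filter.2 ⟨hzA, hxz⟩)
        · exact Finset.mem_union_right _ (Finset.mem_filter.2 ⟨hzA, hcon z hz hxz⟩)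
      have h1 := (Finset.card_le_card hsub).trans (Finset.card_union_le _ _)
      have h2 : 2 * deg x < m := (Finset.mem_filter.1 hxg).2
      have h3 : 2 * deg y < m := (Finset.mem_filter.1 hyg).2
      have h4 : m ≤ deg x + deg y := by rw [← hc]; exact h1
      omega
    obtain ⟨z, hz, hxz, hyz⟩ := hz
    have hzA := hgA (hs hz)
    have l1 : σ x b₀ < σ z b₀ := hg2 (2 * i) (2 * i + 1) (by omega) (by omega) x hx z hz
    have l2 : σ z b₀ < σ y b₀ := hg2 (2 * i + 1) (2 * j) (by omega) (by omega) z hz y hy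
    have nxz : x ≠ z := by rintro rfl; exact lt_irrefl _ l1
    have nyz : y ≠ z := by rintro rfl; exact lt_irrefl _ l2
    have k1 : σ x b < σ z b := by
      rcases lt_trichotomy (σ x b) (σ z b) with h' | h' | h'
      · exact h'
      · exact absurd h' (h.col x hxA z hzA nxz b hb)
      · exact absurd (Finset.mem_filter.2 ⟨Finset.mem_product.2 ⟨hxA, hzA⟩, b₀, hb₀, b, hb, l1, h'⟩)
          hxz
    have k2 : σ z b < σ y b := by
      rcases lt_trichotomy (σ z b) (σ y b) with h' | h' | h'
      · exact h'
      · exact absurd h'.symm (h.col y hyA z hzA nyz b hb)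
      · exact absurd (Finset.mem_filter.2 ⟨Finset.mem_product.2 ⟨hyA, hzA⟩, b, hb, b₀, hb₀, h', l2⟩)
          hyz
    exact k1.trans k2

lemma sum_inc_le {α β ι : Type*} {σ : α → β → ℝ} {A : Finset α} {B : Finset β}
    (h : Half σ A B) (K : ℕ) (gA : ℕ → Finset α) (gB : ℕ → Finset β)
    (hA : ∀ i < K, gA i ⊆ A) (hB : ∀ i < K, gB i ⊆ B) (hBne : B.Nonempty)
    (hAo : ∀ i j, i < j → j < K → ∀ x ∈ gA i, ∀ y ∈ gA j, ∀ b ∈ B, σ x b < σ y b)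
    (hBo : ∀ i j, i < j → j < K → ∀ x ∈ gB i, ∀ y ∈ gB j, ∀ a ∈ A, σ a x < σ a y)
    (S : Finset ι) (f g : ι → ℕ) (hf : ∀ s ∈ S, f s < K) (hg : ∀ s ∈ S, g s < K)
    (hinj : ∀ s ∈ S, ∀ t ∈ S, f s = f t → g s = g t → s = t) :
    ∑ s ∈ S, (inc σ (gA (f s)) (gB (g s))).card ≤ (inc σ A B).card := by
  rw [← Finset.card_biUnion]
  · apply Finset.card_le_card
    intro p hp
    obtain ⟨s, hs, hp⟩ := Finset.mem_biUnion.1 hp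
    simp only [inc, Finset.mem_filter, Finset.mem_product] at hp ⊢
    obtain ⟨⟨h1, h2⟩, b, hb, b', hb', h3⟩ := hp
    exact ⟨⟨hA _ (hf s hs) h1, hA _ (hf s hs) h2⟩, b, hB _ (hg s hs) hb, b', hB _ (hg s hs) hb', h3⟩
  · intro s hs t ht hst
    rw [Function.onFun, Finset.disjoint_left]
    rintro ⟨x, y⟩ hp hq
    simp only [inc, Finset.mem_filter, Finset.mem_product] at hp hq
    obtain ⟨⟨hx, hy⟩, b1, hb1, b1', hb1', h1, h1'⟩ := hp
    obtain ⟨⟨hx', hy'⟩, b2, hb2, b2', hb2', h2, h2'⟩ := hq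
    obtain ⟨b0, hb0⟩ := hBne
    have hxA := hA _ (hf s hs) hx
    have hyA := hA _ (hf s hs) hy
    rcases lt_trichotomy (f s) (f t) with hlt | heq | hlt
    · exact lt_irrefl _ (hAo _ _ hlt (hf t ht) x hx x hx' b0 hb0)
    · have key : ∀ i j, i < j → j < K → ∀ c1 ∈ gB i, ∀ c1' ∈ gB i, ∀ c2 ∈ gB j, ∀ c2' ∈ gB j,
          σ x c1 < σ y c1 → σ y c1' < σ x c1' → σ x c2 < σ y c2 → σ y c2' < σ x c2' → False := by
        intro i j hij hj c1 hc1 c1' hc1' c2 hc2 c2' hc2' e1 e1' e2 e2'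
        have hBi := hB i (hij.trans hj)
        have hBj := hB j hj
        rcases h.thr x hxA y hyA with H | H
        · exact lt_asymm e2' (H c1 (hBi hc1) c2' (hBj hc2')
            (hBo i j hij hj c1 hc1 c2' hc2' x hxA) e1)
        · exact lt_asymm e1' (H c1' (hBi hc1') c2 (hBj hc2)
            (hBo i j hij hj c1' hc1' c2 hc2 x hxA) e2)
      rcases lt_trichotomy (g s) (g t) with hlt' | heq' | hlt'
      · exact key _ _ hlt' (hg t ht) b1 hb1 b1' hb1' b2 hb2 b2' hb2' h1 h1' h2 h2'
      · exact hst (hinj s hs t ht heq heq')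
      · exact key _ _ hlt' (hg s hs) b2 hb2 b2' hb2' b1 hb1 b1' hb1' h2 h2' h1 h1'
    · exact lt_irrefl _ (hAo _ _ hlt (hf s hs) x hx' x hx b0 hb0)

/-- `e` is below `f` in the slope matrix. -/
def Below {α β : Type*} (σ : α → β → ℝ) (e f : α × β) : Prop :=
  σ e.1 e.2 < σ f.1 e.2 ∧ σ e.1 f.2 < σ f.1 f.2 ∧ σ e.1 e.2 < σ e.1 f.2 ∧ σ f.1 e.2 < σ f.1 f.2

theorem main_rec {α β : Type*} (σ : α → β → ℝ) (k : ℕ) (hk : 0 < k) :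
    ∀ (T : ℕ) (A : Finset α) (B : Finset β), Half σ A B → Half (fun b a => σ a b) B A →
      A.card = (5 * k) ^ T → B.card = (5 * k) ^ T →
      ∃ F : Finset (α × β), (∀ e ∈ F, e.1 ∈ A ∧ e.2 ∈ B) ∧
        (∀ e ∈ F, ∀ f ∈ F, e ≠ f → Below σ e f ∨ Below σ f e) ∧
        k ^ (2 * T) ≤ F.card * k ^ T +
          2 * k * ((inc σ A B).card + (inc (fun b a => σ a b) B A).card) := by
  intro T
  induction T with
  | zero =>
    intro A B _ _ hA hB
    simp only [pow_zero] at hA hB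
    obtain ⟨a, rfl⟩ := Finset.card_eq_one.1 hA
    obtain ⟨b, rfl⟩ := Finset.card_eq_one.1 hB
    refine ⟨{(a, b)}, by simp, by simp, by simp⟩
  | succ T ih =>
    intro A B hAB hBA hA hB
    set e := (inc σ A B).card + (inc (fun b a => σ a b) B A).card with he
    by_cases hsmall : k ^ (2 * (T + 1)) ≤ 2 * k * e
    · exact ⟨∅, by simp, by simp, by simpa using hsmall⟩
    push Not at hsmall
    set m := (5 * k) ^ T with hm
    have hm0 : 0 < m := by positivity
    have h2e : 2 * e ≤ k * m ^ 2 := by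
      have h1 : k * (2 * e) < k * (k * (k ^ T) ^ 2) := by
        calc k * (2 * e) = 2 * k * e := by ring
          _ < k ^ (2 * (T + 1)) := hsmall
          _ = _ := by ring
      have h2 := Nat.lt_of_mul_lt_mul_left h1
      have h3 : k ^ T ≤ m := Nat.pow_le_pow_left (by omega) T
      calc 2 * e ≤ k * (k ^ T) ^ 2 := h2.le
        _ ≤ k * m ^ 2 := by gcongr
    have hcA : A.card = 5 * k * m := by rw [hA, hm]; ring
    have hcB : B.card = 5 * k * m := by rw [hB, hm]; ring
    have hpos : 0 < 5 * k * m := by positivity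
    have hAne : A.Nonempty := Finset.card_pos.1 (by omega)
    have hBne : B.Nonempty := Finset.card_pos.1 (by omega)
    obtain ⟨gA, hgA, hgAo⟩ := exists_groups hAB hBne k m hm0 hcA (by omega)
    obtain ⟨gB, hgB, hgBo⟩ := exists_groups hBA hAne k m hm0 hcB (by omega)
    let E : ℕ → ℕ → ℕ := fun i j => (inc σ (gA i) (gB j)).card +
      (inc (fun b a => σ a b) (gB j) (gA i)).card
    have hE : ∑ s ∈ Finset.range k, ∑ i ∈ Finset.range k, E i (i + s) ≤ e := by
      rw [← Finset.sum_product', he, Finset.sum_add_distrib]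
      apply add_le_add
      · apply sum_inc_le hAB (2 * k) gA gB (fun i hi => (hgA i hi).1) (fun i hi => (hgB i hi).1)
          hBne hgAo hgBo _ (fun p : ℕ × ℕ => p.2) (fun p => p.2 + p.1)
        · intro p hp; simp at hp; omega
        · intro p hp; simp at hp; omega
        · rintro ⟨a, b⟩ _ ⟨c, d⟩ _ h1 h2
          simp only at h1 h2
          ext <;> simp <;> omega
      · apply sum_inc_le hBA (2 * k) gB gA (fun i hi => (hgB i hi).1) (fun i hi => (hgA i hi).1)
          hAne hgBo hgAo _ (fun p : ℕ × ℕ => p.2 + p.1) (fun p => p.2)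
        · intro p hp; simp at hp; omega
        · intro p hp; simp at hp; omega
        · rintro ⟨a, b⟩ _ ⟨c, d⟩ _ h1 h2
          simp only at h1 h2
          ext <;> simp <;> omega
    have hs : ∃ s < k, k * ∑ i ∈ Finset.range k, E i (i + s) ≤ e := by
      by_contra hcon
      push Not at hcon
      have h1 : ∑ s ∈ Finset.range k, e < ∑ s ∈ Finset.range k,
          k * ∑ i ∈ Finset.range k, E i (i + s) :=
        Finset.sum_lt_sum_of_nonempty (by simpa using hk.ne')
          (fun s hs => hcon s (Finset.mem_range.1 hs))
      rw [← Finset.mul_sum, Finset.sum_const, Finset.card_range, smul_eq_mul] at h1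
      have := Nat.lt_of_mul_lt_mul_left h1
      omega
    obtain ⟨s, hsk, hs⟩ := hs
    have hF : ∀ i, ∃ F : Finset (α × β), i < k → (∀ e ∈ F, e.1 ∈ gA i ∧ e.2 ∈ gB (i + s)) ∧
        (∀ e ∈ F, ∀ f ∈ F, e ≠ f → Below σ e f ∨ Below σ f e) ∧
        k ^ (2 * T) ≤ F.card * k ^ T + 2 * k * E i (i + s) := by
      intro i
      by_cases hi : i < k
      · obtain ⟨h1, h2⟩ := hgA i (by omega)
        obtain ⟨h3, h4⟩ := hgB (i + s) (by omega)
        obtain ⟨F, hF⟩ := ih (gA i) (gB (i + s)) (hAB.mono h1 h3) (hBA.mono h3 h1) h2 h4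
        exact ⟨F, fun _ => hF⟩
      · exact ⟨∅, fun h => absurd h hi⟩
    choose F hF using hF
    have hcross : ∀ i j, i < j → j < k → ∀ e ∈ F i, ∀ f ∈ F j, Below σ e f := by
      intro i j hij hj e he f hf
      have hi : i < k := hij.trans hj
      obtain ⟨ea, eb⟩ := (hF i hi).1 e he
      obtain ⟨fa, fb⟩ := (hF j hj).1 f hf
      have ha := hgAo i j hij (by omega) _ ea _ fa
      have hb := hgBo (i + s) (j + s) (by omega) (by omega) _ eb _ fb
      exact ⟨ha _ ((hgB (i + s) (by omega)).1 eb), ha _ ((hgB (j + s) (by omega)).1 fb),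
        hb _ ((hgA i (by omega)).1 ea), hb _ ((hgA j (by omega)).1 fa)⟩
    refine ⟨(Finset.range k).biUnion F, ?_, ?_, ?_⟩
    · intro e he
      obtain ⟨i, hi, he⟩ := Finset.mem_biUnion.1 he
      have hi := Finset.mem_range.1 hi
      obtain ⟨ea, eb⟩ := (hF i hi).1 e he
      exact ⟨(hgA i (by omega)).1 ea, (hgB (i + s) (by omega)).1 eb⟩
    · intro e he f hf hef
      obtain ⟨i, hi, he⟩ := Finset.mem_biUnion.1 he
      obtain ⟨j, hj, hf⟩ := Finset.mem_biUnion.1 hf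
      have hi := Finset.mem_range.1 hi
      have hj := Finset.mem_range.1 hj
      rcases lt_trichotomy i j with h | h | h
      · exact Or.inl (hcross i j h hj e he f hf)
      · subst h
        exact (hF i hi).2.1 e he f hf hef
      · exact Or.inr (hcross j i h hi f hf e he)
    · have hcard : ((Finset.range k).biUnion F).card = ∑ i ∈ Finset.range k, (F i).card := by
        apply Finset.card_biUnion
        intro i hi j hj hij
        have hi := Finset.mem_range.1 hi
        have hj := Finset.mem_range.1 hj
        rw [Function.onFun, Finset.disjoint_left]
        intro e he he'
        rcases lt_or_gt_of_ne hij with h | h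
        · exact lt_irrefl _ (hcross i j h hj e he e he').1
        · exact lt_irrefl _ (hcross j i h hi e he' e he).1
      rw [hcard]
      have h1 : ∑ i ∈ Finset.range k, k ^ (2 * T) ≤ ∑ i ∈ Finset.range k,
          ((F i).card * k ^ T + 2 * k * E i (i + s)) :=
        Finset.sum_le_sum fun i hi => (hF i (Finset.mem_range.1 hi)).2.2
      rw [Finset.sum_const, Finset.card_range, smul_eq_mul, Finset.sum_add_distrib,
        ← Finset.sum_mul, ← Finset.mul_sum] at h1
      calc k ^ (2 * (T + 1)) = k * (k * k ^ (2 * T)) := by ring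
        _ ≤ k * ((∑ i ∈ Finset.range k, (F i).card) * k ^ T +
            2 * k * ∑ i ∈ Finset.range k, E i (i + s)) := Nat.mul_le_mul_left _ h1
        _ = (∑ i ∈ Finset.range k, (F i).card) * k ^ (T + 1) +
            2 * k * (k * ∑ i ∈ Finset.range k, E i (i + s)) := by ring
        _ ≤ _ := by gcongr

/-- A continuous order statistic of the functions `v p - s * u p`. -/
lemma exists_ostat {α : Type*} (u v : α → ℝ) (L : Finset α) (M : ℕ) (hM : 0 < M)
    (hL : 2 * M ≤ L.card) :
    ∃ f : ℝ → ℝ, Continuous f ∧ ∀ s, M ≤ (L.filter (fun p => v p - s * u p ≤ f s)).card ∧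
      M ≤ (L.filter (fun p => f s ≤ v p - s * u p)).card ∧ ∃ p ∈ L, f s = v p - s * u p := by
  have hQ : (L.powersetCard M).attach.Nonempty := by
    rw [Finset.attach_nonempty_iff]
    exact Finset.powersetCard_nonempty.2 (by omega)
  have hne : ∀ S : {S // S ∈ L.powersetCard M}, S.1.Nonempty := by
    intro S
    have := (Finset.mem_powersetCard.1 S.2).2
    exact Finset.card_pos.1 (by omega)
  refine ⟨fun s => (L.powersetCard M).attach.inf' hQ
    (fun S => S.1.sup' (hne S) (fun p => v p - s * u p)), ?_, ?_⟩
  · apply Continuous.finset_inf'_apply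
    intro S _
    apply Continuous.finset_sup'_apply
    intro p _
    fun_prop
  · intro s
    beta_reduce
    obtain ⟨S, -, hS⟩ := Finset.exists_mem_eq_inf' hQ
      (fun S : {S // S ∈ L.powersetCard M} => S.1.sup' (hne S) (fun p => v p - s * u p))
    have hSm := Finset.mem_powersetCard.1 S.2
    refine ⟨?_, ?_, ?_⟩
    · rw [hS]
      refine hSm.2.ge.trans (Finset.card_le_card ?_)
      intro p hp
      exact Finset.mem_filter.2 ⟨hSm.1 hp, Finset.le_sup' (fun p => v p - s * u p) hp⟩
    · by_contra hcon
      push Not at hcon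
      set t := (L.powersetCard M).attach.inf' hQ
        (fun S => S.1.sup' (hne S) (fun p => v p - s * u p)) with ht
      have h1 := Finset.card_filter_add_card_filter_not (s := L) (fun p => t ≤ v p - s * u p)
      have h2 : M ≤ (L.filter (fun p => ¬ t ≤ v p - s * u p)).card := by omega
      obtain ⟨S', hS', hc⟩ := Finset.exists_subset_card_eq h2
      have hm : S' ∈ L.powersetCard M :=
        Finset.mem_powersetCard.2 ⟨hS'.trans (Finset.filter_subset _ _), hc⟩
      have h3 : t ≤ S'.sup' (hne ⟨S', hm⟩) (fun p => v p - s * u p) :=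
        Finset.inf'_le (fun S : {S // S ∈ L.powersetCard M} =>
          S.1.sup' (hne S) (fun p => v p - s * u p)) (Finset.mem_attach _ ⟨S', hm⟩)
      have h4 : S'.sup' (hne ⟨S', hm⟩) (fun p => v p - s * u p) < t := by
        rw [Finset.sup'_lt_iff]
        intro p hp
        exact not_le.1 (Finset.mem_filter.1 (hS' hp)).2
      exact absurd h3 (not_le.2 h4)
    · rw [hS]
      obtain ⟨p, hp, h⟩ := Finset.exists_mem_eq_sup' (hne S) (fun p => v p - s * u p)
      exact ⟨p, hSm.1 hp, h⟩

lemma ham_sandwich {α : Type*} (u v : α → ℝ) (L R : Finset α) (M : ℕ) (hM : 0 < M)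
    (hL : 2 * M ≤ L.card) (hR : 2 * M ≤ R.card) (hLR : ∀ p ∈ L, ∀ q ∈ R, u p < u q) :
    ∃ s t : ℝ, M ≤ (L.filter (fun p => v p - s * u p ≤ t)).card ∧
      M ≤ (L.filter (fun p => t ≤ v p - s * u p)).card ∧
      M ≤ (R.filter (fun p => v p - s * u p ≤ t)).card ∧
      M ≤ (R.filter (fun p => t ≤ v p - s * u p)).card := by
  obtain ⟨f, hf, hf'⟩ := exists_ostat u v L M hM hL
  obtain ⟨g, hg, hg'⟩ := exists_ostat u v R M hM hR
  have htop : ∀ᶠ s : ℝ in Filter.atTop, ∀ p ∈ L, ∀ q ∈ R, v q - v p < s * (u q - u p) := by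
    rw [Finset.eventually_all]
    intro p hp
    rw [Finset.eventually_all]
    intro q hq
    have : 0 < u q - u p := sub_pos.2 (hLR p hp q hq)
    filter_upwards [Filter.eventually_gt_atTop ((v q - v p) / (u q - u p))] with s hs
    rwa [div_lt_iff₀ this] at hs
  have hbot : ∀ᶠ s : ℝ in Filter.atBot, ∀ p ∈ L, ∀ q ∈ R, s * (u q - u p) < v q - v p := by
    rw [Finset.eventually_all]
    intro p hp
    rw [Finset.eventually_all]
    intro q hq
    have : 0 < u q - u p := sub_pos.2 (hLR p hp q hq)
    filter_upwards [Filter.eventually_lt_atBot ((v q - v p) / (u q - u p))] with s hs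
    rwa [lt_div_iff₀ this] at hs
  obtain ⟨s1, h1⟩ := htop.exists
  obtain ⟨s2, h2⟩ := hbot.exists
  have hz : (0 : ℝ) ∈ Set.range (fun s => f s - g s) := by
    apply mem_range_of_exists_le_of_exists_ge (hf.sub hg)
    · obtain ⟨p, hp, e1⟩ := (hf' s2).2.2
      obtain ⟨q, hq, e2⟩ := (hg' s2).2.2
      exact ⟨s2, by rw [Pi.sub_apply, e1, e2]; linarith [h2 p hp q hq]⟩
    · obtain ⟨p, hp, e1⟩ := (hf' s1).2.2
      obtain ⟨q, hq, e2⟩ := (hg' s1).2.2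
      exact ⟨s1, by rw [Pi.sub_apply, e1, e2]; linarith [h1 p hp q hq]⟩
  obtain ⟨s, hs⟩ := hz
  have hs : g s = f s := by simp only at hs; linarith
  have h3 := hg' s
  rw [hs] at h3
  exact ⟨s, f s, (hf' s).1, (hf' s).2.1, h3.1, h3.2.1⟩

/-- The line `v = c * u + t` has points of `S` strictly on both sides. -/
def Splits {α : Type*} (u v : α → ℝ) (c t : ℝ) (S : Finset α) : Prop :=
  (∃ p ∈ S, c * u p + t < v p) ∧ ∃ p ∈ S, v p < c * u p + t

lemma Splits.mono {α : Type*} {u v : α → ℝ} {c t : ℝ} {S S' : Finset α} (h : Splits u v c t S)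
    (hS : S ⊆ S') : Splits u v c t S' := by
  obtain ⟨⟨p, hp, h1⟩, q, hq, h2⟩ := h
  exact ⟨⟨p, hS hp, h1⟩, q, hS hq, h2⟩

lemma exists_three {α : Type*} (u v : α → ℝ) (S : Finset α) (M : ℕ) (hM : 0 < M)
    (hu : Set.InjOn u S) (hS : 6 * M ≤ S.card) :
    ∃ g : Fin 3 → Finset α, (∀ i, g i ⊆ S ∧ M ≤ (g i).card) ∧
      ∀ c t, ∃ i, ¬ Splits u v c t (g i) := by
  obtain ⟨h, hh, ho⟩ := exists_blocks u (2 * M) 3 S hu (by omega)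
  obtain ⟨s, t, a1, a2, a3, a4⟩ := ham_sandwich u v (h 0) (h 2) M hM (hh 0 (by omega)).2.ge
    (hh 2 (by omega)).2.ge (ho 0 2 (by omega) (by omega))
  have hmid : M ≤ ((h 1).filter (fun p => v p - s * u p ≤ t)).card ∨
      M ≤ ((h 1).filter (fun p => t ≤ v p - s * u p)).card := by
    by_contra hcon
    push Not at hcon
    have h1 := Finset.card_filter_add_card_filter_not (s := h 1) (fun p => v p - s * u p ≤ t)
    have h2 : ((h 1).filter (fun p => ¬ v p - s * u p ≤ t)).card ≤
        ((h 1).filter (fun p => t ≤ v p - s * u p)).card := by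
      apply Finset.card_le_card
      intro p hp
      simp only [Finset.mem_filter, not_le] at hp ⊢
      exact ⟨hp.1, hp.2.le⟩
    have := (hh 1 (by omega)).2
    omega
  have hsub : ∀ (i : ℕ) (hi : i < 3) (P : α → Prop), (h i).filter P ⊆ S := fun i hi P =>
    (Finset.filter_subset _ _).trans (hh i hi).1
  rcases hmid with hm | hm
  · refine ⟨![(h 0).filter (fun p => t ≤ v p - s * u p), (h 1).filter (fun p => v p - s * u p ≤ t),
      (h 2).filter (fun p => t ≤ v p - s * u p)], ?_, ?_⟩
    · intro i
      fin_cases i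
      · exact ⟨hsub 0 (by omega) _, a2⟩
      · exact ⟨hsub 1 (by omega) _, hm⟩
      · exact ⟨hsub 2 (by omega) _, a4⟩
    · intro c t'
      by_contra hcon
      push Not at hcon
      obtain ⟨-, p, hp, hp'⟩ := hcon 0
      obtain ⟨⟨r, hr, hr'⟩, -⟩ := hcon 1
      obtain ⟨-, q, hq, hq'⟩ := hcon 2
      simp only [Matrix.cons_val, Finset.mem_filter] at hp hr hq
      have o1 := ho 0 1 (by omega) (by omega) p hp.1 r hr.1
      have o2 := ho 1 2 (by omega) (by omega) r hr.1 q hq.1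
      have e1 : 0 < (c - s) * u p + (t' - t) := by linarith [hp.2]
      have e2 : 0 < (c - s) * u q + (t' - t) := by linarith [hq.2]
      have e3 : (c - s) * u r + (t' - t) < 0 := by linarith [hr.2]
      nlinarith
  · refine ⟨![(h 0).filter (fun p => v p - s * u p ≤ t), (h 1).filter (fun p => t ≤ v p - s * u p),
      (h 2).filter (fun p => v p - s * u p ≤ t)], ?_, ?_⟩
    · intro i
      fin_cases i
      · exact ⟨hsub 0 (by omega) _, a1⟩
      · exact ⟨hsub 1 (by omega) _, hm⟩
      · exact ⟨hsub 2 (by omega) _, a3⟩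
    · intro c t'
      by_contra hcon
      push Not at hcon
      obtain ⟨⟨p, hp, hp'⟩, -⟩ := hcon 0
      obtain ⟨-, r, hr, hr'⟩ := hcon 1
      obtain ⟨⟨q, hq, hq'⟩, -⟩ := hcon 2
      simp only [Matrix.cons_val, Finset.mem_filter] at hp hr hq
      have o1 := ho 0 1 (by omega) (by omega) p hp.1 r hr.1
      have o2 := ho 1 2 (by omega) (by omega) r hr.1 q hq.1
      have e1 : (c - s) * u p + (t' - t) < 0 := by linarith [hp.2]
      have e2 : (c - s) * u q + (t' - t) < 0 := by linarith [hq.2]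
      have e3 : 0 < (c - s) * u r + (t' - t) := by linarith [hr.2]
      nlinarith

lemma exists_partition {α : Type*} (u v : α → ℝ) (m : ℕ) (hm : 0 < m) :
    ∀ (d : ℕ) (S : Finset α), Set.InjOn u S → 6 ^ d * m ≤ S.card →
      ∃ (I : Type) (_ : Fintype I) (g : I → Finset α), Fintype.card I = 3 ^ d ∧
        (∀ i, g i ⊆ S ∧ (g i).card = m) ∧
        ∀ c t, (∑ i, if Splits u v c t (g i) then 1 else 0) ≤ 2 ^ d := by
  intro d
  induction d with
  | zero =>
    intro S _ hS
    obtain ⟨S', h1, h2⟩ := Finset.exists_subset_card_eq (s := S) (n := m) (by simpa using hS)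
    refine ⟨Unit, inferInstance, fun _ => S', by simp, fun _ => ⟨h1, h2⟩, fun c t => ?_⟩
    simp only [Finset.univ_unique, Finset.sum_const, Finset.card_singleton, pow_zero]
    split_ifs <;> simp
  | succ d ih =>
    intro S hu hS
    obtain ⟨G, hG, hG'⟩ := exists_three u v S (6 ^ d * m) (by positivity) hu
      (by rw [← mul_assoc, ← pow_succ']; exact hS)
    have key := fun i => ih (G i) (hu.mono (by exact_mod_cast (hG i).1)) (hG i).2
    choose I inst g hI hg hs using key
    refine ⟨Σ i, I i, inferInstance, fun x => g x.1 x.2, ?_, ?_, ?_⟩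
    · rw [Fintype.card_sigma]
      simp [hI, pow_succ']
    · rintro ⟨i, x⟩
      exact ⟨(hg i x).1.trans (hG i).1, (hg i x).2⟩
    · intro c t
      rw [Fintype.sum_sigma]
      obtain ⟨i0, hi0⟩ := hG' c t
      have h0 : (∑ x, if Splits u v c t (g i0 x) then 1 else 0) = 0 := by
        apply Finset.sum_eq_zero
        intro x _
        rw [if_neg]
        exact fun h => hi0 (h.mono (hg i0 x).1)
      have hsc := fun i => hs i c t
      rw [Fin.sum_univ_three, pow_succ]
      beta_reduce
      dsimp only
      have b0 := hsc 0
      have b1 := hsc 1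
      have b2 := hsc 2
      fin_cases i0
      · simp only [Fin.zero_eta] at h0; omega
      · simp only [Fin.mk_one] at h0; omega
      · simp only [Fin.reduceFinMk] at h0; omega

/-- The slope of the segment between two points. -/
noncomputable def slp {α : Type*} (u v : α → ℝ) (a b : α) : ℝ := (v b - v a) / (u b - u a)

/-- Orientation determinant in the coordinates `u`, `v`. -/
def det3 {α : Type*} (u v : α → ℝ) (p q r : α) : ℝ :=
  (u q - u p) * (v r - v p) - (v q - v p) * (u r - u p)

lemma slp_sub {α : Type*} (u v : α → ℝ) {x y b : α} (hx : u x < u b) (hy : u y < u b) :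
    slp u v y b - slp u v x b = det3 u v x y b / ((u b - u x) * (u b - u y)) := by
  have h1 : u b - u x ≠ 0 := (sub_pos.2 hx).ne'
  have h2 : u b - u y ≠ 0 := (sub_pos.2 hy).ne'
  unfold slp det3
  field_simp
  ring

lemma slp_sub' {α : Type*} (u v : α → ℝ) {x y b : α} (hx : u x < u b) (hy : u y < u b)
    (hxy : u x ≠ u y) :
    slp u v y b - slp u v x b =
      (u y - u x) / (u b - u y) * (slp u v x b - slp u v x y) := by
  have h1 : u b - u x ≠ 0 := (sub_pos.2 hx).ne'
  have h2 : u b - u y ≠ 0 := (sub_pos.2 hy).ne'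
  have h3 : u y - u x ≠ 0 := sub_ne_zero.2 hxy.symm
  unfold slp
  field_simp
  ring

lemma slp_line {α : Type*} (u v : α → ℝ) {x b : α} (c : ℝ) (hx : u x < u b) :
    v b - (c * u b + (v x - c * u x)) = (u b - u x) * (slp u v x b - c) := by
  have h1 : u b - u x ≠ 0 := (sub_pos.2 hx).ne'
  unfold slp
  field_simp
  ring

lemma half_slp {α : Type*} (u v : α → ℝ) (A B : Finset α) (hlt : ∀ a ∈ A, ∀ b ∈ B, u a < u b)
    (hu : Set.InjOn u A)
    (hdet : ∀ x ∈ A, ∀ y ∈ A, x ≠ y → ∀ b ∈ B, det3 u v x y b ≠ 0) : Half (slp u v) A B := by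
  constructor
  · intro x hx y hy hne b hb h
    have h1 := slp_sub u v (hlt x hx b hb) (hlt y hy b hb)
    rw [h, sub_self] at h1
    have h2 : (u b - u x) * (u b - u y) ≠ 0 :=
      mul_ne_zero (sub_pos.2 (hlt x hx b hb)).ne' (sub_pos.2 (hlt y hy b hb)).ne'
    exact (div_ne_zero (hdet x hx y hy hne b hb) h2) h1.symm
  · intro x hx y hy
    by_cases hne : x = y
    · subst hne
      exact Or.inl fun b _ b' _ _ h => absurd h (lt_irrefl _)
    have hne' : u x ≠ u y := fun h => hne (hu hx hy h)
    rcases lt_or_gt_of_ne hne' with h | h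
    · left
      intro b hb b' hb' h1 h2
      have e := slp_sub' u v (hlt x hx b hb) (hlt y hy b hb) hne'
      have e' := slp_sub' u v (hlt x hx b' hb') (hlt y hy b' hb') hne'
      have p : 0 < (u y - u x) / (u b - u y) :=
        div_pos (sub_pos.2 h) (sub_pos.2 (hlt y hy b hb))
      have p' : 0 < (u y - u x) / (u b' - u y) :=
        div_pos (sub_pos.2 h) (sub_pos.2 (hlt y hy b' hb'))
      have q : 0 < slp u v x b - slp u v x y := by
        rw [← sub_pos, e] at h2
        exact (mul_pos_iff_of_pos_left p).1 h2
      have : 0 < slp u v y b' - slp u v x b' := by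
        rw [e']
        exact mul_pos p' (by linarith)
      linarith
    · right
      intro b hb b' hb' h1 h2
      have e := slp_sub' u v (hlt x hx b hb) (hlt y hy b hb) hne'
      have e' := slp_sub' u v (hlt x hx b' hb') (hlt y hy b' hb') hne'
      have p : (u y - u x) / (u b - u y) < 0 :=
        div_neg_of_neg_of_pos (sub_neg.2 h) (sub_pos.2 (hlt y hy b hb))
      have p' : (u y - u x) / (u b' - u y) < 0 :=
        div_neg_of_neg_of_pos (sub_neg.2 h) (sub_pos.2 (hlt y hy b' hb'))
      have q : slp u v x b' - slp u v x y < 0 := by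
        rw [← sub_pos, e'] at h2
        by_contra hcon
        push Not at hcon
        nlinarith
      have : 0 < slp u v y b - slp u v x b := by
        rw [e]
        exact mul_pos_of_neg_of_neg p (by linarith)
      linarith

lemma inc_splits {α : Type*} (u v : α → ℝ) (A B : Finset α)
    (hlt : ∀ a ∈ A, ∀ b ∈ B, u a < u b) (hu : Set.InjOn u A) (x y : α) (hx : x ∈ A) (hy : y ∈ A) :
    ∃ c t, ∀ A' B' : Finset α, B' ⊆ B → (x, y) ∈ inc (slp u v) A' B' → Splits u v c t B' := by
  refine ⟨slp u v x y, v x - slp u v x y * u x, ?_⟩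
  intro A' B' hB' hinc
  simp only [inc, Finset.mem_filter] at hinc
  obtain ⟨-, b, hb, b', hb', h1, h2⟩ := hinc
  have hne : x ≠ y := by rintro rfl; exact lt_irrefl _ h1
  have hne' : u x ≠ u y := fun h => hne (hu hx hy h)
  have hbB := hB' hb
  have hbB' := hB' hb'
  have e := slp_sub' u v (hlt x hx b hbB) (hlt y hy b hbB) hne'
  have e' := slp_sub' u v (hlt x hx b' hbB') (hlt y hy b' hbB') hne'
  have l := slp_line u v (slp u v x y) (hlt x hx b hbB)
  have l' := slp_line u v (slp u v x y) (hlt x hx b' hbB')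
  have r : 0 < u b - u x := sub_pos.2 (hlt x hx b hbB)
  have r' : 0 < u b' - u x := sub_pos.2 (hlt x hx b' hbB')
  have w : 0 < u b - u y := sub_pos.2 (hlt y hy b hbB)
  have w' : 0 < u b' - u y := sub_pos.2 (hlt y hy b' hbB')
  rw [← sub_pos, e] at h1
  rw [← sub_neg, e'] at h2
  rcases lt_or_gt_of_ne hne' with h | h
  · have p : 0 < (u y - u x) / (u b - u y) := div_pos (sub_pos.2 h) w
    have p' : 0 < (u y - u x) / (u b' - u y) := div_pos (sub_pos.2 h) w'
    have q : 0 < slp u v x b - slp u v x y := (mul_pos_iff_of_pos_left p).1 h1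
    have q' : slp u v x b' - slp u v x y < 0 := by
      by_contra hcon; push Not at hcon; nlinarith
    exact ⟨⟨b, hb, by nlinarith⟩, b', hb', by nlinarith⟩
  · have p : (u y - u x) / (u b - u y) < 0 := div_neg_of_neg_of_pos (sub_neg.2 h) w
    have p' : (u y - u x) / (u b' - u y) < 0 := div_neg_of_neg_of_pos (sub_neg.2 h) w'
    have q : slp u v x b - slp u v x y < 0 := by
      by_contra hcon; push Not at hcon; nlinarith
    have q' : 0 < slp u v x b' - slp u v x y := by
      by_contra hcon; push Not at hcon; nlinarith
    exact ⟨⟨b', hb', by nlinarith⟩, b, hb, by nlinarith⟩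

lemma sum_inc_splits {α I : Type*} [Fintype I] (u v : α → ℝ) (A B A' : Finset α)
    (hlt : ∀ a ∈ A, ∀ b ∈ B, u a < u b) (hu : Set.InjOn u A) (hA' : A' ⊆ A)
    (g : I → Finset α) (hg : ∀ i, g i ⊆ B) (D : ℕ)
    (hD : ∀ c t, (∑ i, if Splits u v c t (g i) then 1 else 0) ≤ D) :
    ∑ i, (inc (slp u v) A' (g i)).card ≤ A'.card ^ 2 * D := by
  have h1 : ∀ i, (inc (slp u v) A' (g i)).card =
      ∑ p ∈ A' ×ˢ A', if p ∈ inc (slp u v) A' (g i) then 1 else 0 := by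
    intro i
    rw [← Finset.card_filter]
    congr 1
    ext p
    simp only [inc, Finset.mem_filter]
    exact ⟨fun h => ⟨h.1, h⟩, fun h => h.2⟩
  simp_rw [h1]
  rw [Finset.sum_comm]
  have h2 : ∀ p ∈ A' ×ˢ A', (∑ i, if p ∈ inc (slp u v) A' (g i) then 1 else 0) ≤ D := by
    rintro ⟨x, y⟩ hp
    obtain ⟨hx, hy⟩ := Finset.mem_product.1 hp
    obtain ⟨c, t, h⟩ := inc_splits u v A B hlt hu x y (hA' hx) (hA' hy)
    refine le_trans (Finset.sum_le_sum fun i _ => ?_) (hD c t)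
    by_cases hi : (x, y) ∈ inc (slp u v) A' (g i)
    · rw [if_pos hi, if_pos (h A' (g i) (hg i) hi)]
    · rw [if_neg hi]; exact Nat.zero_le _
  refine (Finset.sum_le_card_nsmul _ _ _ h2).trans ?_
  rw [Finset.card_product, smul_eq_mul, pow_two]

lemma slp_neg {α : Type*} (u v : α → ℝ) :
    slp (fun p => - u p) (fun p => - v p) = fun b a => slp u v a b := by
  funext b a
  unfold slp
  congr 1 <;> ring

lemma splits_neg {α : Type*} (u v : α → ℝ) (c t : ℝ) (S : Finset α)
    (h : Splits (fun p => - u p) (fun p => - v p) c t S) : Splits u v c (-t) S := by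
  obtain ⟨⟨p, hp, h1⟩, q, hq, h2⟩ := h
  exact ⟨⟨q, hq, by linarith⟩, p, hp, by linarith⟩

lemma exists_avoiding {α : Type*} (u v : α → ℝ) (A B : Finset α)
    (hlt : ∀ a ∈ A, ∀ b ∈ B, u a < u b) (hA : Set.InjOn u A) (hB : Set.InjOn u B)
    (m d : ℕ) (hm : 0 < m) (hcA : 6 ^ d * m ≤ A.card) (hcB : 6 ^ d * m ≤ B.card) :
    ∃ A' B' : Finset α, A' ⊆ A ∧ B' ⊆ B ∧ A'.card = m ∧ B'.card = m ∧
      3 ^ d * ((inc (slp u v) A' B').card + (inc (fun b a => slp u v a b) B' A').card) ≤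
        2 * 2 ^ d * m ^ 2 := by
  obtain ⟨I, _, gA, hI, hgA, hsA⟩ := exists_partition u v m hm d A hA hcA
  obtain ⟨J, _, gB, hJ, hgB, hsB⟩ := exists_partition u v m hm d B hB hcB
  by_contra hcon
  push Not at hcon
  have h1 : ∀ i, ∑ j, (inc (slp u v) (gA i) (gB j)).card ≤ m ^ 2 * 2 ^ d := by
    intro i
    have := sum_inc_splits u v A B (gA i) hlt hA (hgA i).1 gB (fun j => (hgB j).1) _ hsB
    rwa [(hgA i).2] at this
  have h2 : ∀ j, ∑ i, (inc (fun b a => slp u v a b) (gB j) (gA i)).card ≤ m ^ 2 * 2 ^ d := by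
    intro j
    have := sum_inc_splits (fun p => - u p) (fun p => - v p) B A (gB j)
      (fun b hb a ha => neg_lt_neg (hlt a ha b hb)) (fun x hx y hy h => hB hx hy (neg_injective h))
      (hgB j).1 gA (fun i => (hgA i).1) (2 ^ d) (by
        intro c t
        refine le_trans (Finset.sum_le_sum fun i _ => ?_) (hsA c (-t))
        by_cases hi : Splits (fun p => - u p) (fun p => - v p) c t (gA i)
        · rw [if_pos hi, if_pos (splits_neg u v c t _ hi)]
        · rw [if_neg hi]; exact Nat.zero_le _)
    rwa [(hgB j).2, slp_neg] at this
  have h3 : ∑ i, ∑ j, ((inc (slp u v) (gA i) (gB j)).card +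
      (inc (fun b a => slp u v a b) (gB j) (gA i)).card) ≤ 3 ^ d * (2 * 2 ^ d * m ^ 2) := by
    simp_rw [Finset.sum_add_distrib]
    rw [Finset.sum_comm (f := fun i j => (inc (fun b a => slp u v a b) (gB j) (gA i)).card)]
    have e1 := Finset.sum_le_card_nsmul Finset.univ _ _ (fun i _ => h1 i)
    have e2 := Finset.sum_le_card_nsmul Finset.univ _ _ (fun j _ => h2 j)
    rw [Finset.card_univ, smul_eq_mul] at e1 e2
    rw [hI] at e1
    rw [hJ] at e2
    calc _ ≤ _ := add_le_add e1 e2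
      _ = _ := by ring
  have hIne : (Finset.univ : Finset I).Nonempty := by
    rw [← Finset.card_pos, Finset.card_univ, hI]; positivity
  have hJne : (Finset.univ : Finset J).Nonempty := by
    rw [← Finset.card_pos, Finset.card_univ, hJ]; positivity
  have h4 : ∑ i : I, ∑ j : J, 2 * 2 ^ d * m ^ 2 < ∑ i, ∑ j,
      3 ^ d * ((inc (slp u v) (gA i) (gB j)).card +
      (inc (fun b a => slp u v a b) (gB j) (gA i)).card) :=
    Finset.sum_lt_sum_of_nonempty hIne fun i _ => Finset.sum_lt_sum_of_nonempty hJne fun j _ =>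
      hcon (gA i) (gB j) (hgA i).1 (hgB j).1 (hgA i).2 (hgB j).2
  simp_rw [← Finset.mul_sum] at h4
  simp only [Finset.sum_const, Finset.card_univ, smul_eq_mul, hI, hJ] at h4
  have h5 := h4.trans_le (Nat.mul_le_mul_left _ h3)
  exact absurd h5 (not_lt.2 (le_of_eq (by ring)))

lemma det3_neg {α : Type*} (u v : α → ℝ) (p q r : α) :
    det3 (fun p => - u p) (fun p => - v p) p q r = det3 u v p q r := by
  unfold det3; ring

/-- The quantitative core. -/
theorem core {α : Type*} (u v : α → ℝ) (A B : Finset α)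
    (hlt : ∀ a ∈ A, ∀ b ∈ B, u a < u b) (hA : Set.InjOn u A) (hB : Set.InjOn u B)
    (hdA : ∀ x ∈ A, ∀ y ∈ A, x ≠ y → ∀ b ∈ B, det3 u v x y b ≠ 0)
    (hdB : ∀ x ∈ B, ∀ y ∈ B, x ≠ y → ∀ a ∈ A, det3 u v x y a ≠ 0)
    (l T : ℕ) (hl : 0 < l) (hT : T ≤ l)
    (hcA : 2 ^ (47 * l + (l + 3) * T) ≤ A.card) (hcB : 2 ^ (47 * l + (l + 3) * T) ≤ B.card) :
    ∃ F : Finset (α × α), (∀ e ∈ F, e.1 ∈ A ∧ e.2 ∈ B) ∧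
      (∀ e ∈ F, ∀ f ∈ F, e ≠ f → Below (slp u v) e f ∨ Below (slp u v) f e) ∧
      2 ^ (l * T) ≤ 2 * F.card := by
  set k := 2 ^ l with hk
  have hk0 : 0 < k := by positivity
  set m := (5 * k) ^ T with hm
  have hm0 : 0 < m := by positivity
  have hsz : 6 ^ (18 * l) * m ≤ 2 ^ (47 * l + (l + 3) * T) := by
    rw [pow_add, pow_mul, pow_mul, pow_mul, hm]
    apply Nat.mul_le_mul
    · exact Nat.pow_le_pow_left (by norm_num) _
    · apply Nat.pow_le_pow_left
      rw [pow_add, hk]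
      omega
  obtain ⟨A', B', hA', hB', cA, cB, he⟩ := exists_avoiding u v A B hlt hA hB m (18 * l) hm0
    (hsz.trans hcA) (hsz.trans hcB)
  have half1 := (half_slp u v A B hlt hA hdA).mono hA' hB'
  have half2 := (half_slp (fun p => - u p) (fun p => - v p) B A
    (fun b hb a ha => neg_lt_neg (hlt a ha b hb)) (fun x hx y hy h => hB hx hy (neg_injective h))
    (fun x hx y hy hne b hb => by rw [det3_neg]; exact hdB x hx y hy hne b hb)).mono hB' hA'
  rw [slp_neg] at half2
  obtain ⟨F, hF1, hF2, hF3⟩ := main_rec (slp u v) k hk0 T A' B' half1 half2 cA cB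
  refine ⟨F, fun e he => ⟨hA' (hF1 e he).1, hB' (hF1 e he).2⟩, hF2, ?_⟩
  set E := (inc (slp u v) A' B').card + (inc (fun b a => slp u v a b) B' A').card with hE
  have h1 : 4 * k * E ≤ k ^ (2 * T) := by
    have hpos : 0 < 3 ^ (18 * l) := by positivity
    apply Nat.le_of_mul_le_mul_left _ hpos
    have h25 : 25 ^ T ≤ 25 ^ l := Nat.pow_le_pow_right (by norm_num) hT
    have h8 : 8 ^ 1 ≤ 8 ^ l := Nat.pow_le_pow_right (by norm_num) hl
    calc 3 ^ (18 * l) * (4 * k * E) = 4 * k * (3 ^ (18 * l) * E) := by ring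
      _ ≤ 4 * k * (2 * 2 ^ (18 * l) * m ^ 2) := Nat.mul_le_mul_left _ he
      _ = 8 ^ 1 * 2 ^ l * (2 ^ 18) ^ l * 25 ^ T * k ^ (2 * T) := by
        rw [hm, ← pow_mul, mul_pow, mul_comm T 2, pow_mul 5 2 T, ← pow_mul 2 18 l, hk]
        norm_num
        ring
      _ ≤ 8 ^ l * 2 ^ l * (2 ^ 18) ^ l * 25 ^ l * k ^ (2 * T) := by gcongr
      _ = (8 * 2 * 2 ^ 18 * 25) ^ l * k ^ (2 * T) := by simp only [mul_pow]
      _ ≤ (3 ^ 18) ^ l * k ^ (2 * T) :=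
        Nat.mul_le_mul_right _ (Nat.pow_le_pow_left (by norm_num) l)
      _ = 3 ^ (18 * l) * k ^ (2 * T) := by rw [← pow_mul]
  have h2 : k ^ T * k ^ T ≤ (2 * F.card) * k ^ T := by
    have e1 : k ^ T * k ^ T = k ^ (2 * T) := by ring
    have e2 : 4 * k * E = 2 * (2 * k * E) := by ring
    have e3 : 2 * F.card * k ^ T = 2 * (F.card * k ^ T) := by ring
    omega
  have h3 := Nat.le_of_mul_le_mul_right h2 (by positivity)
  rw [pow_mul]
  exact h3

lemma numeric (n l q : ℕ) (hl : 0 < l) (hq : q ≤ l ^ 2) (hn1 : 2 ^ q ≤ n) (hn2 : n < 2 ^ (q + 1)) :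
    n ≤ 2 ^ (58 * l) ∨ ∃ T ≤ l, 2 ^ (47 * l + (l + 3) * T) * 4 ≤ n ∧
      ∀ f : ℕ, 2 ^ (l * T) ≤ 2 * f → n ≤ f * 2 ^ (58 * l) := by
  by_cases h : q < 49 * l
  · left
    exact hn2.le.trans (Nat.pow_le_pow_right (by norm_num) (by omega))
  · right
    push Not at h
    have hd := Nat.div_add_mod (q - 49 * l) (l + 3)
    have hr := Nat.mod_lt (q - 49 * l) (show 0 < l + 3 by omega)
    set T := (q - 49 * l) / (l + 3) with hT
    set r := (q - 49 * l) % (l + 3)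
    have hTl : T ≤ l := by
      by_contra hcon
      push Not at hcon
      have : (l + 3) * T ≤ l ^ 2 := by omega
      nlinarith
    have hmul : (l + 3) * T = l * T + 3 * T := by ring
    refine ⟨T, hTl, ?_, ?_⟩
    · calc 2 ^ (47 * l + (l + 3) * T) * 4 = 2 ^ (47 * l + (l + 3) * T + 2) := by
            rw [pow_add _ _ 2]; norm_num
        _ ≤ 2 ^ q := Nat.pow_le_pow_right (by norm_num) (by omega)
        _ ≤ n := hn1
    · intro f hf
      have h1 : n ≤ 2 ^ (l * T + (58 * l - 1)) :=
        hn2.le.trans (Nat.pow_le_pow_right (by norm_num) (by omega))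
      calc n ≤ 2 ^ (l * T) * 2 ^ (58 * l - 1) := by rw [← pow_add]; exact h1
        _ ≤ 2 * f * 2 ^ (58 * l - 1) := Nat.mul_le_mul_right _ hf
        _ = f * 2 ^ (58 * l - 1 + 1) := by rw [pow_succ]; ring
        _ = f * 2 ^ (58 * l) := by congr 2; omega

lemma det_ne_zero {P : Finset Pt} (hP : GenPos P) {p q r : Pt} (hp : p ∈ P) (hq : q ∈ P)
    (hr : r ∈ P) (hpq : p ≠ q) (hpr : p ≠ r) (hqr : q ≠ r) :
    det3 Prod.fst Prod.snd p q r ≠ 0 := by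
  intro h
  apply hP p hp q hq r hr hpq hpr hqr
  unfold det3 at h
  rw [collinear_iff_of_mem (p₀ := p) (by simp)]
  refine ⟨q - p, ?_⟩
  have hr' : ∃ t : ℝ, r = t • (q - p) +ᵥ p := by
    by_cases h1 : q.1 - p.1 = 0
    · have h2 : q.2 - p.2 ≠ 0 := by
        intro h2
        exact hpq (Prod.ext (by linarith) (by linarith))
      refine ⟨(r.2 - p.2) / (q.2 - p.2), ?_⟩
      rw [h1] at h
      have h3 : r.1 - p.1 = 0 := by
        have : (q.2 - p.2) * (r.1 - p.1) = 0 := by linarith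
        exact (mul_eq_zero.1 this).resolve_left h2
      apply Prod.ext
      · simp [h1]; linarith
      · simp only [vadd_eq_add, Prod.snd_add, Prod.smul_snd, Prod.snd_sub, smul_eq_mul]
        field_simp
        ring
    · refine ⟨(r.1 - p.1) / (q.1 - p.1), ?_⟩
      apply Prod.ext
      · simp only [vadd_eq_add, Prod.fst_add, Prod.smul_fst, Prod.fst_sub, smul_eq_mul]
        field_simp
        ring
      · simp only [vadd_eq_add, Prod.snd_add, Prod.smul_snd, Prod.snd_sub, smul_eq_mul]
        field_simp
        linarith
  intro x hx
  simp only [Set.mem_insert_iff, Set.mem_singleton_iff] at hx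
  rcases hx with rfl | rfl | rfl
  · exact ⟨0, by simp⟩
  · exact ⟨1, by simp⟩
  · exact hr'

lemma segCross_of_det {a a' b b' : Pt} (h1 : 0 < det3 Prod.fst Prod.snd a a' b)
    (h2 : 0 < det3 Prod.fst Prod.snd a a' b') (h3 : 0 < det3 Prod.fst Prod.snd b b' a)
    (h4 : 0 < det3 Prod.fst Prod.snd b b' a') : SegCross (a, b) (a', b') := by
  obtain ⟨a1, a2⟩ := a
  obtain ⟨c1, c2⟩ := a'
  obtain ⟨b1, b2⟩ := b
  obtain ⟨d1, d2⟩ := b'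
  unfold det3 at h1 h2 h3 h4
  simp only at h1 h2 h3 h4
  set D := (b1 - a1) * (d2 - c2) - (b2 - a2) * (d1 - c1) with hD
  set s := (c1 - a1) * (d2 - a2) - (c2 - a2) * (d1 - a1) with hs
  set s' := (d1 - b1) * (c2 - b2) - (d2 - b2) * (c1 - b1) with hs'
  set r := (c1 - a1) * (b2 - a2) - (c2 - a2) * (b1 - a1) with hr
  set r' := (d1 - b1) * (a2 - b2) - (d2 - b2) * (a1 - b1) with hr'
  have e1 : s + s' = D := by rw [hs, hs', hD]; ring
  have e2 : r + r' = D := by rw [hr, hr', hD]; ring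
  have hDpos : 0 < D := by linarith
  have hx : ((s' / D) * a1 + (s / D) * b1, (s' / D) * a2 + (s / D) * b2) =
      ((r' / D) * c1 + (r / D) * d1, (r' / D) * c2 + (r / D) * d2) := by
    apply Prod.ext
    · simp only
      field_simp
      rw [hs, hs', hr, hr']
      ring
    · simp only
      field_simp
      rw [hs, hs', hr, hr']
      ring
  have m1 : ((s' / D) * a1 + (s / D) * b1, (s' / D) * a2 + (s / D) * b2) ∈
      openSegment ℝ ((a1, a2) : Pt) (b1, b2) := by
    refine ⟨s' / D, s / D, by positivity, by positivity, ?_, by simp⟩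
    rw [← add_div, add_comm, e1, div_self hDpos.ne']
  have m2 : ((s' / D) * a1 + (s / D) * b1, (s' / D) * a2 + (s / D) * b2) ∈
      openSegment ℝ ((c1, c2) : Pt) (d1, d2) := by
    rw [hx]
    refine ⟨r' / D, r / D, by positivity, by positivity, ?_, by simp⟩
    rw [← add_div, add_comm, e2, div_self hDpos.ne']
  refine ⟨_, ?_, m1, m2⟩
  apply Set.eq_singleton_iff_unique_mem.2
  refine ⟨⟨openSegment_subset_segment _ _ _ m1, openSegment_subset_segment _ _ _ m2⟩, ?_⟩
  rintro ⟨y1, y2⟩ ⟨⟨p, q, hp, hq, hpq, hy⟩, ⟨p', q', hp', hq', hpq', hy'⟩⟩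
  simp only [Prod.smul_mk, smul_eq_mul, Prod.mk_add_mk, Prod.mk.injEq] at hy hy'
  have hp1 : p = 1 - q := by linarith
  have hp2 : p' = 1 - q' := by linarith
  subst hp1 hp2
  have hq : q = s / D := by
    rw [eq_div_iff hDpos.ne', hs, hD]
    have k1 : q * (b1 - a1) = q' * (d1 - c1) + (c1 - a1) := by linarith [hy.1, hy'.1]
    have k2 : q * (b2 - a2) = q' * (d2 - c2) + (c2 - a2) := by linarith [hy.2, hy'.2]
    linear_combination (d2 - c2) * k1 - (d1 - c1) * k2
  have hq2 : 1 - q = s' / D := by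
    rw [hq, ← e1]
    have : s + s' ≠ 0 := by rw [e1]; exact hDpos.ne'
    field_simp
    ring
  apply Prod.ext
  · simp only
    rw [← hy.1, hq2, ← hq]
  · simp only
    rw [← hy.2, hq2, ← hq]

lemma exists_coords {A B : Finset Pt} (hA : A.Nonempty) (hB : B.Nonempty) (hAB : Separated A B) :
    ∃ (u v : Pt → ℝ) (κ : ℝ), 0 < κ ∧ Set.InjOn u ((A ∪ B : Finset Pt) : Set Pt) ∧
      (∀ a ∈ A, ∀ b ∈ B, u a < u b) ∧
      ∀ p q r, det3 u v p q r = κ * det3 Prod.fst Prod.snd p q r := by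
  obtain ⟨f, x, y, h1, h2, h3⟩ := geometric_hahn_banach_compact_closed
    (convex_convexHull ℝ (A : Set Pt)) (A.finite_toSet.isCompact_convexHull ℝ)
    (convex_convexHull ℝ (B : Set Pt)) (B.finite_toSet.isCompact_convexHull ℝ).isClosed hAB
  set α := f (1, 0) with hα
  set β := f (0, 1) with hβ
  have hf : ∀ p : Pt, f p = α * p.1 + β * p.2 := by
    intro p
    have : p = p.1 • ((1, 0) : Pt) + p.2 • ((0, 1) : Pt) := by
      apply Prod.ext <;> simp
    conv_lhs => rw [this]
    rw [map_add, map_smul, map_smul, smul_eq_mul, smul_eq_mul]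
    ring
  have hsep : ∀ a ∈ A, ∀ b ∈ B, f a < f b := by
    intro a ha b hb
    have := h1 a (subset_convexHull ℝ _ ha)
    have := h3 b (subset_convexHull ℝ _ hb)
    linarith
  have hκ : 0 < α ^ 2 + β ^ 2 := by
    by_contra hcon
    have ha : α = 0 := by nlinarith [sq_nonneg α, sq_nonneg β]
    have hb : β = 0 := by nlinarith [sq_nonneg α, sq_nonneg β]
    obtain ⟨a, ha'⟩ := hA
    obtain ⟨b, hb'⟩ := hB
    have := hsep a ha' b hb'
    rw [hf, hf, ha, hb] at this
    simp at this
  let w : Pt → ℝ := fun p => - β * p.1 + α * p.2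
  have hinj : ∀ p q : Pt, f p = f q → w p = w q → p = q := by
    intro p q e1 e2
    rw [hf, hf] at e1
    simp only [w] at e2
    have g1 : (α ^ 2 + β ^ 2) * (p.1 - q.1) = 0 := by linear_combination α * e1 - β * e2
    have g2 : (α ^ 2 + β ^ 2) * (p.2 - q.2) = 0 := by linear_combination β * e1 + α * e2
    have g1' := (mul_eq_zero.1 g1).resolve_left hκ.ne'
    have g2' := (mul_eq_zero.1 g2).resolve_left hκ.ne'
    exact Prod.ext (by linarith) (by linarith)
  have cont : ∀ p : Pt, Filter.Tendsto (fun t : ℝ => f p + t * w p)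
      (nhdsWithin 0 (Set.Ioi 0)) (nhds (f p)) := by
    intro p
    have : Continuous (fun t : ℝ => f p + t * w p) := by fun_prop
    have h := this.tendsto 0
    simp only [zero_mul, add_zero] at h
    exact h.mono_left nhdsWithin_le_nhds
  have ev1 : ∀ᶠ t : ℝ in nhdsWithin 0 (Set.Ioi 0), ∀ a ∈ A, ∀ b ∈ B,
      f a + t * w a < f b + t * w b := by
    rw [Finset.eventually_all]
    intro a ha
    rw [Finset.eventually_all]
    intro b hb
    exact (cont a).eventually_lt (cont b) (hsep a ha b hb)
  have ev2 : ∀ᶠ t : ℝ in nhdsWithin 0 (Set.Ioi 0), ∀ p ∈ A ∪ B, ∀ q ∈ A ∪ B,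
      f p + t * w p = f q + t * w q → p = q := by
    rw [Finset.eventually_all]
    intro p hp
    rw [Finset.eventually_all]
    intro q hq
    by_cases hpq : f p = f q
    · filter_upwards [self_mem_nhdsWithin] with t ht heq
      have ht : 0 < t := ht
      apply hinj p q hpq
      have : t * w p = t * w q := by linarith
      exact mul_left_cancel₀ ht.ne' this
    · have := ((cont p).sub (cont q)).eventually_ne (sub_ne_zero.2 hpq)
      filter_upwards [this] with t ht heq
      exact absurd (sub_eq_zero.2 heq) ht
  obtain ⟨t, ht1, ht2⟩ := (ev1.and ev2).exists
  refine ⟨fun p => f p + t * w p, w, α ^ 2 + β ^ 2, hκ, ?_, ht1, ?_⟩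
  · intro p hp q hq h
    exact ht2 p (by exact_mod_cast hp) q (by exact_mod_cast hq) h
  · intro p q r
    unfold det3
    simp only [hf, w]
    ring

lemma segCross_symm {e f : Pt × Pt} (h : SegCross e f) : SegCross f e := by
  obtain ⟨x, h1, h2, h3⟩ := h
  exact ⟨x, by rw [Set.inter_comm]; exact h1, h3, h2⟩

lemma det_of_slp {α : Type*} (u v : α → ℝ) {x y b : α} (hx : u x < u b) (hy : u y < u b)
    (h : slp u v x b < slp u v y b) : 0 < det3 u v x y b := by
  have h1 := slp_sub u v hx hy
  have h2 : 0 < (u b - u x) * (u b - u y) := mul_pos (sub_pos.2 hx) (sub_pos.2 hy)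
  rw [← sub_pos, h1] at h
  exact (div_pos_iff_of_pos_right h2).1 h

lemma segCross_of_below (u v : Pt → ℝ) (κ : ℝ) (hκ : 0 < κ)
    (hdet : ∀ p q r, det3 u v p q r = κ * det3 Prod.fst Prod.snd p q r) (A B : Finset Pt)
    (hlt : ∀ a ∈ A, ∀ b ∈ B, u a < u b) {e f : Pt × Pt} (he : e.1 ∈ A ∧ e.2 ∈ B)
    (hf : f.1 ∈ A ∧ f.2 ∈ B) (h : Below (slp u v) e f) : SegCross e f := by
  obtain ⟨a, b⟩ := e
  obtain ⟨a', b'⟩ := f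
  obtain ⟨ha, hb⟩ := he
  obtain ⟨ha', hb'⟩ := hf
  obtain ⟨h1, h2, h3, h4⟩ := h
  simp only at ha hb ha' hb' h1 h2 h3 h4
  have g1 := det_of_slp u v (hlt a ha b hb) (hlt a' ha' b hb) h1
  have g2 := det_of_slp u v (hlt a ha b' hb') (hlt a' ha' b' hb') h2
  have g3 := det_of_slp (fun p => - u p) (fun p => - v p) (x := b) (y := b') (b := a)
    (neg_lt_neg (hlt a ha b hb)) (neg_lt_neg (hlt a ha b' hb')) (by rw [slp_neg]; exact h3)
  have g4 := det_of_slp (fun p => - u p) (fun p => - v p) (x := b) (y := b') (b := a')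
    (neg_lt_neg (hlt a' ha' b hb)) (neg_lt_neg (hlt a' ha' b' hb')) (by rw [slp_neg]; exact h4)
  rw [det3_neg] at g3 g4
  rw [hdet] at g1 g2 g3 g4
  exact segCross_of_det (pos_of_mul_pos_right g1 hκ.le) (pos_of_mul_pos_right g2 hκ.le)
    (pos_of_mul_pos_right g3 hκ.le) (pos_of_mul_pos_right g4 hκ.le)

lemma nat_version (P A B : Finset Pt) (hP : 2 ≤ P.card) (hgen : GenPos P) (hun : A ∪ B = P)
    (hdis : Disjoint A B) (hsep : Separated A B)
    (hbal : ((A.card : ℤ) - (B.card : ℤ)).natAbs ≤ 1) (l : ℕ) (hl : 0 < l)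
    (hq : Nat.log 2 P.card ≤ l ^ 2) :
    ∃ F : Finset (Pt × Pt), P.card ≤ F.card * 2 ^ (58 * l) ∧ (∀ e ∈ F, e.1 ∈ A ∧ e.2 ∈ B) ∧
        ∀ e ∈ F, ∀ f ∈ F, e ≠ f → SegCross e f := by
  have hcard : A.card + B.card = P.card := by rw [← hun, Finset.card_union_of_disjoint hdis]
  have hA : A.Nonempty := Finset.card_pos.1 (by omega)
  have hB : B.Nonempty := Finset.card_pos.1 (by omega)
  rcases numeric P.card l (Nat.log 2 P.card) hl hq (Nat.pow_log_le_self 2 (by omega))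
    (Nat.lt_pow_succ_log_self (by norm_num) _) with h | ⟨T, hT, hsz, hfin⟩
  · obtain ⟨a, ha⟩ := hA
    obtain ⟨b, hb⟩ := hB
    refine ⟨{(a, b)}, by simpa using h, by simp [ha, hb], ?_⟩
    intro e he f hf hne
    rw [Finset.mem_singleton] at he hf
    exact absurd (he.trans hf.symm) hne
  · obtain ⟨u, v, κ, hκ, hinj, hlt, hdet⟩ := exists_coords hA hB hsep
    have hAP : A ⊆ P := hun ▸ Finset.subset_union_left
    have hBP : B ⊆ P := hun ▸ Finset.subset_union_right
    have hne : ∀ a ∈ A, ∀ b ∈ B, a ≠ b := fun a ha b hb h =>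
      Finset.disjoint_left.1 hdis ha (h ▸ hb)
    obtain ⟨F, hF1, hF2, hF3⟩ := core u v A B hlt
      (hinj.mono (by exact_mod_cast Finset.subset_union_left))
      (hinj.mono (by exact_mod_cast Finset.subset_union_right))
      (fun x hx y hy hxy b hb => by
        rw [hdet]
        exact mul_ne_zero hκ.ne' (det_ne_zero hgen (hAP hx) (hAP hy) (hBP hb) hxy
          (hne x hx b hb) (hne y hy b hb)))
      (fun x hx y hy hxy a ha => by
        rw [hdet]
        exact mul_ne_zero hκ.ne' (det_ne_zero hgen (hBP hx) (hBP hy) (hAP ha) hxy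
          (hne a ha x hx).symm (hne a ha y hy).symm))
      l T hl hT (by omega) (by omega)
    refine ⟨F, hfin _ hF3, hF1, ?_⟩
    intro e he f hf hef
    rcases hF2 e he f hf hef with h | h
    · exact segCross_of_below u v κ hκ hdet A B hlt (hF1 e he) (hF1 f hf) h
    · exact segCross_symm (segCross_of_below u v κ hκ hdet A B hlt (hF1 f hf) (hF1 e he) h)

end CF

/-- There exists a constant `c > 0` such that for every set `P` of `n ≥ 2` points
in the plane in general position and every partition of `P` into two separated subsets `P₁`,
`P₂` with `||P₁| − |P₂|| ≤ 1`, `P` contains a crossing family of size at least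
`n / 2^(c·√(log₂ n))` in which every segment has one endpoint in `P₁` and one in `P₂`. -/
theorem stmt3 :
    ∃ c : ℝ, 0 < c ∧ ∀ P P₁ P₂ : Finset Pt, 2 ≤ P.card → GenPos P →
      P₁ ∪ P₂ = P → Disjoint P₁ P₂ → Separated P₁ P₂ →
      ((P₁.card : ℤ) - (P₂.card : ℤ)).natAbs ≤ 1 →
      ∃ F : Finset (Pt × Pt),
        (P.card : ℝ) / 2 ^ (c * Real.sqrt (Real.logb 2 (P.card : ℝ))) ≤ (F.card : ℝ) ∧
        (∀ e ∈ F, e.1 ∈ P₁ ∧ e.2 ∈ P₂) ∧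
        ∀ e ∈ F, ∀ f ∈ F, e ≠ f → SegCross e f := by
  refine ⟨116, by norm_num, ?_⟩
  intro P P₁ P₂ hP hgen hun hdis hsep hbal
  set n := P.card with hn
  have hn1 : (1 : ℝ) ≤ Real.logb 2 n := by
    rw [Real.le_logb_iff_rpow_le (by norm_num) (by positivity), Real.rpow_one]
    exact_mod_cast hP
  set L := Real.sqrt (Real.logb 2 n) with hL
  have hL1 : 1 ≤ L := by
    rw [hL, Real.one_le_sqrt]
    exact hn1
  have hLsq : L ^ 2 = Real.logb 2 n := Real.sq_sqrt (by linarith)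
  have hceil := Nat.le_ceil L
  have hceil2 := Nat.ceil_lt_add_one (show 0 ≤ L by linarith)
  have hl0 : 0 < ⌈L⌉₊ := Nat.ceil_pos.2 (by linarith)
  have hq : Nat.log 2 n ≤ ⌈L⌉₊ ^ 2 := by
    have h1 : ((Nat.log 2 n : ℕ) : ℝ) ≤ Real.logb 2 n := by
      rw [Real.le_logb_iff_rpow_le (by norm_num) (by positivity), Real.rpow_natCast]
      exact_mod_cast Nat.pow_log_le_self 2 (by omega)
    have h2 : ((Nat.log 2 n : ℕ) : ℝ) ≤ ((⌈L⌉₊ : ℕ) : ℝ) ^ 2 := by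
      rw [← hLsq] at h1
      nlinarith
    exact_mod_cast h2
  obtain ⟨F, hF1, hF2, hF3⟩ := CF.nat_version P P₁ P₂ hP hgen hun hdis hsep hbal _ hl0 hq
  refine ⟨F, ?_, hF2, hF3⟩
  have hpos : (0 : ℝ) < 2 ^ (116 * L) := by positivity
  rw [div_le_iff₀ hpos]
  have h1 : (n : ℝ) ≤ (F.card : ℝ) * 2 ^ (58 * ⌈L⌉₊) := by exact_mod_cast hF1
  refine h1.trans (mul_le_mul_of_nonneg_left ?_ (by positivity))
  rw [← Real.rpow_natCast]
  apply Real.rpow_le_rpow_of_exponent_le (by norm_num)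
  push_cast
  linarith
end
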